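/- arXiv:1705.10704 — 4 statements merged into one kernel-verified Lean document; each statement's English description precedes it below -/
import Mathlib

section
/- Fix λ ∈ 𝔻∖{0}. There exists a constant c = c(λ) > 0, depending only on λ, such that for every integer n ≥ 1 the following holds: every function f holomorphic on 𝔻 with absolutely summable Taylor coefficients that satisfies f(0) = λⁿ and has a zero of order at least n at λ (i.e., f(z)/(z−λ)ⁿ extends holomorphically to 𝔻) satisfies ∑_{k≥1} |f̂(k)| ≥ c·√n. In other words, the Gluskin–Meyer–Pajor quantity φ(λ,…,λ) (n copies) is at least c(λ)·√n. -/
open Complex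

theorem integral_abs_deriv_div_sq_add_le {p p' : ℝ → ℝ} {m x y : ℝ} (hm : 0 < m) (hxy : x ≤ y)
    (hp : ∀ t, HasDerivAt p (p' t) t) (hp' : Continuous p') (hpos : ∀ t ∈ Set.Icc x y, 0 ≤ p' t) :
    ∫ t in x..y, |p' t| / (p t ^ 2 + m) ≤ Real.pi / √m := by
  have hs : 0 < √m := Real.sqrt_pos.2 hm
  have hsq : √m ^ 2 = m := Real.sq_sqrt hm.le
  have hpc : Continuous p := continuous_iff_continuousAt.2 fun t => (hp t).continuousAt
  have hden : ∀ t, p t ^ 2 + m ≠ 0 := fun t => by positivity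
  have key : ∫ t in x..y, |p' t| / (p t ^ 2 + m) =
      Real.arctan (p y / √m) / √m - Real.arctan (p x / √m) / √m := by
    rw [← intervalIntegral.integral_eq_sub_of_hasDerivAt
      (f := fun t => Real.arctan (p t / √m) / √m) (f' := fun t => p' t / (p t ^ 2 + m))]
    · refine intervalIntegral.integral_congr fun t ht => ?_
      rw [Set.uIcc_of_le hxy] at ht
      simp only [abs_of_nonneg (hpos t ht)]
    · intro t _
      refine ((((hp t).div_const √m).arctan).div_const √m).congr_deriv ?_
      have h1 : 1 + (p t / √m) ^ 2 = (p t ^ 2 + m) / m := by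
        rw [div_pow, hsq]; field_simp; ring
      rw [h1]
      have := hden t
      field_simp
      rw [hsq, mul_comm]
    · exact (hp'.div (by fun_prop) hden).intervalIntegrable _ _
  rw [key, ← sub_div]
  have h1 := Real.arctan_lt_pi_div_two (p y / √m)
  have h2 := Real.neg_pi_div_two_lt_arctan (p x / √m)
  gcongr
  linarith

theorem norm_integral_mul_le_of_oscillating {a a' u : ℝ → ℂ} {p p' : ℝ → ℝ} {K L A m : ℝ}
    (hm : 0 < m) (hK0 : 0 ≤ K)
    (ha : ∀ t, HasDerivAt a (a' t) t) (ha' : Continuous a') (haA : ∀ t, ‖a' t‖ ≤ A)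
    (hp : ∀ t, HasDerivAt p (p' t) t) (hp' : Continuous p')
    (hpos : ∀ t ∈ Set.Icc 0 Real.pi, 0 ≤ p' t)
    (hneg : ∀ t ∈ Set.Icc Real.pi (2 * Real.pi), p' t ≤ 0)
    (hK : ∀ t, m * ‖a t‖ ≤ K * |p' t|) (hL : ∀ t, |p' t| ≤ L * m)
    (hu : ∀ t, HasDerivAt u (I * p t * u t) t) (hu1 : ∀ t, ‖u t‖ = 1)
    (ha0 : a (2 * Real.pi) = a 0) (hp0 : p (2 * Real.pi) = p 0) (hu0 : u (2 * Real.pi) = u 0) :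
    ‖∫ t in 0..2 * Real.pi, a t * u t‖ ≤
      (2 * Real.pi * (K * (1 + L)) + Real.pi * A) / √m := by
  have hs : 0 < √m := Real.sqrt_pos.2 hm
  have hsq : √m ^ 2 = m := Real.sq_sqrt hm.le
  have hpi := Real.pi_pos
  have hpc : Continuous p := continuous_iff_continuousAt.2 fun t => (hp t).continuousAt
  have hac : Continuous a := continuous_iff_continuousAt.2 fun t => (ha t).continuousAt
  have huc : Continuous u := continuous_iff_continuousAt.2 fun t => (hu t).continuousAt
  have hden0 : ∀ t, 0 < p t ^ 2 + m := fun t => by positivity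
  have hden : ∀ t, p t ^ 2 + m ≠ 0 := fun t => (hden0 t).ne'
  have hA0 : 0 ≤ A := (norm_nonneg _).trans (haA 0)
  set q : ℝ → ℝ := fun t => p t / (p t ^ 2 + m) with hq
  set q' : ℝ → ℝ := fun t => p' t * (m - p t ^ 2) / (p t ^ 2 + m) ^ 2 with hq'
  have hqd : ∀ t, HasDerivAt q (q' t) t := fun t => by
    refine ((hp t).div (((hp t).pow 2).add_const m) (hden t)).congr_deriv ?_
    simp only [hq', Pi.pow_apply]
    congr 1
    push_cast
    ring
  have hqc : Continuous q := hpc.div (by fun_prop) hden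
  have hq'c : Continuous q' := by
    refine Continuous.div (by fun_prop) (by fun_prop) fun t => pow_ne_zero 2 (hden t)
  set R : ℝ → ℂ := fun t =>
    u t * (a t * (m / (p t ^ 2 + m) : ℝ) + I * a' t * q t + I * a t * q' t) with hR
  have hmc : Continuous fun t => m / (p t ^ 2 + m) := Continuous.div (by fun_prop) (by fun_prop) hden
  have hRc : Continuous R := by fun_prop
  have hΦ : ∀ t, HasDerivAt (fun t => -I * (u t * a t) * (q t : ℂ)) (a t * u t - R t) t := fun t => by
    refine ((((hu t).mul (ha t)).const_mul (-I)).mul (hqd t).ofReal_comp).congr_deriv ?_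
    have h1 : ((m / (p t ^ 2 + m) : ℝ) : ℂ) = 1 - p t * q t := by
      rw [← ofReal_one, ← ofReal_mul, ← ofReal_sub]
      congr 1
      simp only [hq]
      have := hden t
      field_simp
      ring
    simp only [hR, h1, Pi.mul_apply]
    linear_combination (-p t * u t * a t * q t) * I_sq
  have h0 : ∫ t in 0..2 * Real.pi, (a t * u t - R t) = 0 := by
    rw [intervalIntegral.integral_eq_sub_of_hasDerivAt (fun t _ => hΦ t)
      ((by fun_prop : Continuous fun t => a t * u t - R t).intervalIntegrable _ _)]
    simp only [hq, ha0, hp0, hu0, sub_self]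
  rw [intervalIntegral.integral_sub (((by fun_prop : Continuous fun t => a t * u t)).intervalIntegrable _ _)
    (hRc.intervalIntegrable _ _), sub_eq_zero] at h0
  rw [h0]
  set w : ℝ → ℝ := fun t => |p' t| / (p t ^ 2 + m) with hw
  have hwc : Continuous w := Continuous.div (by fun_prop) (by fun_prop) hden
  have hRb : ∀ t, ‖R t‖ ≤ K * (1 + L) * w t + A / (2 * √m) := fun t => by
    have hd := hden0 t
    have e1 : ‖a t‖ * (m / (p t ^ 2 + m)) ≤ K * w t := by
      simp only [hw]
      rw [← mul_div_assoc, ← mul_div_assoc, mul_comm]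
      exact div_le_div_of_nonneg_right (hK t) hd.le
    have e2 : |q t| ≤ 1 / (2 * √m) := by
      rw [hq, abs_div, abs_of_pos hd, div_le_div_iff₀ hd (by positivity)]
      have := sq_nonneg (|p t| - √m)
      nlinarith [sq_abs (p t)]
    have e3 : |q' t| ≤ L * (m / (p t ^ 2 + m)) := by
      have : |m - p t ^ 2| ≤ p t ^ 2 + m := by
        rw [abs_le]; constructor <;> nlinarith [sq_nonneg (p t)]
      simp only [hq']
      rw [abs_div, abs_mul, abs_of_pos (pow_pos hd 2), ← mul_div_assoc,
        div_le_div_iff₀ (pow_pos hd 2) hd]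
      have := mul_le_mul (hL t) this (abs_nonneg _) ((abs_nonneg _).trans (hL t))
      nlinarith
    have hL0 : 0 ≤ L := by
      have := (abs_nonneg _).trans (hL t)
      exact nonneg_of_mul_nonneg_left this hm
    calc ‖R t‖ ≤ ‖a t‖ * (m / (p t ^ 2 + m)) + ‖a' t‖ * |q t| + ‖a t‖ * |q' t| := by
          simp only [hR]
          rw [norm_mul, hu1, one_mul]
          refine (norm_add₃_le).trans_eq ?_
          simp only [norm_mul, norm_I, one_mul, norm_real, Real.norm_eq_abs]
          rw [abs_of_pos (div_pos hm hd)]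
      _ ≤ K * w t + A * (1 / (2 * √m)) + ‖a t‖ * (L * (m / (p t ^ 2 + m))) := by
          gcongr
          exact haA t
      _ ≤ K * w t + A * (1 / (2 * √m)) + L * (K * w t) := by
          have := mul_le_mul_of_nonneg_left e1 hL0
          linarith
      _ = _ := by ring
  have hI1 : ∫ t in 0..Real.pi, w t ≤ Real.pi / √m :=
    integral_abs_deriv_div_sq_add_le hm hpi.le hp hp' hpos
  have hI2 : ∫ t in Real.pi..2 * Real.pi, w t ≤ Real.pi / √m := by
    have := integral_abs_deriv_div_sq_add_le (p := fun t => -p t) (p' := fun t => -p' t) hm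
      (by linarith : Real.pi ≤ 2 * Real.pi) (fun t => (hp t).neg) hp'.neg
      (fun t ht => neg_nonneg.2 (hneg t ht))
    simpa only [abs_neg, neg_sq] using this
  have hI : ∫ t in 0..2 * Real.pi, w t ≤ 2 * Real.pi / √m := by
    rw [← intervalIntegral.integral_add_adjacent_intervals (hwc.intervalIntegrable 0 Real.pi)
      (hwc.intervalIntegrable _ _)]
    calc _ ≤ _ := add_le_add hI1 hI2
      _ = _ := by ring
  have hL0 : 0 ≤ L := nonneg_of_mul_nonneg_left ((abs_nonneg _).trans (hL 0)) hm
  calc ‖∫ t in 0..2 * Real.pi, R t‖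
      ≤ ∫ t in 0..2 * Real.pi, (K * (1 + L) * w t + A / (2 * √m)) :=
        intervalIntegral.norm_integral_le_of_norm_le (by positivity)
          (Filter.Eventually.of_forall fun t _ => hRb t)
          ((by fun_prop : Continuous fun t => K * (1 + L) * w t + A / (2 * √m)).intervalIntegrable
            _ _)
    _ = K * (1 + L) * (∫ t in 0..2 * Real.pi, w t) + 2 * Real.pi * (A / (2 * √m)) := by
        rw [intervalIntegral.integral_add ((hwc.const_mul _).intervalIntegrable _ _)
          (continuous_const.intervalIntegrable _ _), intervalIntegral.integral_const_mul,
          intervalIntegral.integral_const]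
        simp
    _ ≤ K * (1 + L) * (2 * Real.pi / √m) + 2 * Real.pi * (A / (2 * √m)) := by gcongr
    _ = _ := by field_simp

theorem HasDerivAt.pow_of_logDeriv {v : ℝ → ℂ} {c : ℂ} {t : ℝ} (h : HasDerivAt v (c * v t) t)
    (m : ℕ) : HasDerivAt (fun s => v s ^ m) (m * c * v t ^ m) t := by
  refine (h.fun_pow m).congr_deriv ?_
  cases m with
  | zero => simp
  | succ m => simp only [Nat.add_sub_cancel]; ring

theorem exists_norm_integral_blaschke_le {r : ℝ} (hr0 : 0 < r) (hr1 : r < 1) :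
    ∃ C : ℝ, ∀ m : ℕ, 0 < m → ∀ k : ℕ,
      ‖∫ t in 0..2 * Real.pi, (exp (t * I) ^ 2 - 1) / (exp (t * I) - r) ^ 2 *
        (exp (t * I) ^ k * ((1 - r * exp (t * I)) / (exp (t * I) - r)) ^ m)‖ ≤ C / √m := by
  set z : ℝ → ℂ := fun t => exp (t * I) with hz
  set D : ℝ → ℝ := fun t => 1 - 2 * r * Real.cos t + r ^ 2 with hD
  have hzcs : ∀ t, z t = Real.cos t + Real.sin t * I := fun t => by
    simp only [hz, exp_mul_I, ofReal_cos, ofReal_sin]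
  have hcs : ∀ t : ℝ, (Real.sin t : ℂ) ^ 2 + (Real.cos t : ℂ) ^ 2 = 1 := fun t => by
    exact_mod_cast Real.sin_sq_add_cos_sq t
  have hzn : ∀ t, ‖z t‖ = 1 := fun t => norm_exp_ofReal_mul_I t
  have hzd : ∀ t, HasDerivAt z (I * z t) t := fun t => by
    refine (((hasDerivAt_id t).ofReal_comp.mul_const I).cexp).congr_deriv ?_
    simp [hz, mul_comm]
  have hzp : z (2 * Real.pi) = z 0 := by simp [hz]
  have hDlow : ∀ t, (1 - r) ^ 2 ≤ D t := fun t => by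
    simp only [hD]; nlinarith [Real.cos_le_one t]
  have hDup : ∀ t, D t ≤ 4 := fun t => by
    simp only [hD]; nlinarith [Real.neg_one_le_cos t]
  have h1r : 0 < 1 - r := by linarith
  have h1r2 : 0 < 1 - r ^ 2 := by nlinarith
  have hDpos : ∀ t, 0 < D t := fun t => (pow_pos h1r 2).trans_le (hDlow t)
  have hDc : Continuous D := by simp only [hD]; fun_prop
  have hDd : ∀ t, HasDerivAt D (2 * r * Real.sin t) t := fun t => by
    refine ((((Real.hasDerivAt_cos t).const_mul (2 * r)).const_sub 1).add_const (r ^ 2)).congr_deriv ?_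
    ring
  have hnorm1 : ∀ t, ‖z t - r‖ ^ 2 = D t := fun t => by
    rw [← normSq_eq_norm_sq, hzcs, normSq_apply]
    simp [-ofReal_cos, -ofReal_sin]
    simp only [hD]
    nlinarith [Real.sin_sq_add_cos_sq t]
  have hnorm2 : ∀ t, ‖1 - r * z t‖ ^ 2 = D t := fun t => by
    rw [← normSq_eq_norm_sq, hzcs, normSq_apply]
    simp [-ofReal_cos, -ofReal_sin]
    simp only [hD]
    linear_combination r ^ 2 * Real.sin_sq_add_cos_sq t
  have hnormeq : ∀ t, ‖1 - r * z t‖ = ‖z t - r‖ := fun t =>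
    (pow_left_inj₀ (norm_nonneg _) (norm_nonneg _) two_ne_zero).1 ((hnorm2 t).trans (hnorm1 t).symm)
  have hzr : ∀ t, z t - r ≠ 0 := fun t h => by
    have := hnorm1 t
    rw [h, norm_zero, zero_pow two_ne_zero] at this
    exact (hDpos t).ne this
  have hprod : ∀ t, (1 - r * z t) * (z t - r) = z t * D t := fun t => by
    rw [hzcs]
    simp only [hD]
    have := hcs t
    push_cast at this ⊢
    linear_combination (-(r : ℂ) * Complex.sin t ^ 2) * I_sq + (r : ℂ) * this
  have hsin : ∀ t, z t ^ 2 - 1 = 2 * I * Real.sin t * z t := fun t => by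
    rw [hzcs]
    push_cast
    have := hcs t
    push_cast at this
    linear_combination this - (Complex.sin t ^ 2) * I_sq
  have hnorma : ∀ t, ‖(z t ^ 2 - 1) / (z t - r) ^ 2‖ = 2 * |Real.sin t| / D t := fun t => by
    rw [norm_div, norm_pow, hnorm1, hsin]
    simp [hzn, -ofReal_sin]
  refine ⟨2 * Real.pi * (4 / (r * (1 - r ^ 2)) * (1 + 2 / ((1 - r) ^ 2) ^ 2)) +
    Real.pi * (2 / (1 - r) ^ 2), fun m hm k => ?_⟩
  have hm' : (0 : ℝ) < m := by exact_mod_cast hm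
  refine norm_integral_mul_le_of_oscillating
    (a := fun t => (z t ^ 2 - 1) / (z t - r) ^ 2)
    (a' := fun t => 2 * I * z t * (1 - r * z t) / (z t - r) ^ 3)
    (u := fun t => z t ^ k * ((1 - r * z t) / (z t - r)) ^ m)
    (p := fun t => k - m * ((1 - r ^ 2) / D t))
    (p' := fun t => m * ((1 - r ^ 2) * (2 * r * Real.sin t) / D t ^ 2))
    hm' (by positivity) ?_ ?_ ?_ ?_ ?_ ?_ ?_ ?_ ?_ ?_ ?_ ?_ ?_ ?_
  · intro t
    refine (((hzd t).fun_pow 2 |>.sub_const 1).div ((hzd t).sub_const (r : ℂ) |>.fun_pow 2)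
      (pow_ne_zero 2 (hzr t))).congr_deriv ?_
    have := hzr t
    field_simp
    push_cast
    ring
  · have hzc : Continuous z := by fun_prop
    exact Continuous.div (by fun_prop) (by fun_prop) fun t => pow_ne_zero 3 (hzr t)
  · intro t
    have h0 : 0 < ‖z t - r‖ := norm_pos_iff.2 (hzr t)
    have : ‖2 * I * z t * (1 - r * z t) / (z t - r) ^ 3‖ = 2 / D t := by
      rw [← hnorm1]
      simp only [norm_div, norm_mul, norm_pow, hnormeq, hzn, norm_I]
      norm_num
      field_simp
    simp only [this]
    gcongr
    exact hDlow t
  · intro t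
    refine ((((hasDerivAt_const t (1 - r ^ 2)).div (hDd t) (hDpos t).ne').const_mul (m : ℝ)).const_sub
      (k : ℝ)).congr_deriv ?_
    ring
  · exact continuous_const.mul (Continuous.div (by fun_prop) (by fun_prop)
      fun t => pow_ne_zero 2 (hDpos t).ne')
  · intro t ht
    have := Real.sin_nonneg_of_mem_Icc ht
    positivity
  · intro t ht
    have hs : Real.sin t ≤ 0 := by
      have := Real.sin_nonneg_of_nonneg_of_le_pi (x := t - Real.pi) (by linarith [ht.1])
        (by linarith [ht.2])
      rw [Real.sin_sub_pi] at this
      linarith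
    refine mul_nonpos_of_nonneg_of_nonpos hm'.le (div_nonpos_of_nonpos_of_nonneg ?_ (sq_nonneg _))
    exact mul_nonpos_of_nonneg_of_nonpos h1r2.le
      (mul_nonpos_of_nonneg_of_nonpos (by positivity) hs)
  · intro t
    have hd := hDpos t
    simp only [hnorma]
    rw [abs_mul, abs_div, abs_mul, abs_mul, abs_of_pos hm', abs_of_pos h1r2,
      abs_of_pos (by positivity : 0 < 2 * r), abs_of_pos (pow_pos hd 2)]
    have : 4 / (r * (1 - r ^ 2)) * (m * ((1 - r ^ 2) * (2 * r * |Real.sin t|) / D t ^ 2)) =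
        m * (2 * |Real.sin t| / D t) * (4 / D t) := by
      field_simp
    rw [this]
    refine le_mul_of_one_le_right (by positivity) ?_
    rw [one_le_div hd]
    exact hDup t
  · intro t
    have hd := hDpos t
    rw [abs_mul, abs_of_pos hm', mul_comm]
    gcongr
    rw [abs_div, abs_of_pos (pow_pos hd 2)]
    have h1 : |(1 - r ^ 2) * (2 * r * Real.sin t)| ≤ 2 := by
      rw [abs_mul, abs_mul, abs_of_pos h1r2, abs_of_pos (by positivity : 0 < 2 * r)]
      have h3 : (1 - r ^ 2) * (2 * r * |Real.sin t|) ≤ 1 * (2 * 1 * 1) := by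
        gcongr
        · nlinarith
        · exact Real.abs_sin_le_one t
      linarith
    gcongr
    exact hDlow t
  · intro t
    have hv : HasDerivAt (fun s => (1 - r * z s) / (z s - r))
        ((-I * ((1 - r ^ 2) / D t : ℝ)) * ((1 - r * z t) / (z t - r))) t := by
      refine (((hzd t).const_mul (r : ℂ) |>.const_sub 1).div ((hzd t).sub_const (r : ℂ))
        (hzr t)).congr_deriv ?_
      have h1 := hzr t
      have h2 : (D t : ℂ) ≠ 0 := by exact_mod_cast (hDpos t).ne'
      push_cast
      field_simp
      linear_combination (1 - (r : ℂ) ^ 2) * hprod t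
    refine (((hzd t).pow_of_logDeriv k).mul (hv.pow_of_logDeriv m)).congr_deriv ?_
    push_cast
    ring
  · intro t
    have h0 : ‖z t - r‖ ≠ 0 := norm_ne_zero_iff.2 (hzr t)
    simp only [norm_mul, norm_pow, norm_div, hzn, hnormeq, div_self h0, one_pow, mul_one]
  · simp only [hzp]
  · simp [hD]
  · simp only [hzp]

theorem two_pi_le_of_dvd_sub_pow {r B : ℝ} (hr0 : 0 < r) (hr1 : r < 1) {m : ℕ}
    (hB : ∀ k : ℕ, ‖∫ t in 0..2 * Real.pi, (exp (t * I) ^ 2 - 1) / (exp (t * I) - r) ^ 2 *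
        (exp (t * I) ^ k * ((1 - r * exp (t * I)) / (exp (t * I) - r)) ^ m)‖ ≤ B)
    {fc : ℕ → ℂ} (hs : Summable fun k => ‖fc k‖) (h0 : ‖fc 0‖ = r ^ (m + 2)) {g : ℂ → ℂ}
    (hg : DifferentiableOn ℂ g (Metric.ball 0 1))
    (hfg : ∀ z ∈ Metric.ball (0 : ℂ) 1, ∑' k, fc k * z ^ k = (z - r) ^ (m + 2) * g z) :
    2 * Real.pi ≤ B * ∑' k, ‖fc k‖ := by
  have hpi := Real.pi_pos
  have hrball : (r : ℂ) ∈ Metric.ball (0 : ℂ) 1 := by simp [abs_of_pos hr0, hr1]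
  have hr0' : (r : ℂ) ≠ 0 := by exact_mod_cast hr0.ne'
  set f : ℂ → ℂ := fun z => ∑' k, fc k * z ^ k with hf
  have hfc : ContinuousOn f (Metric.closedBall 0 1) := by
    refine continuousOn_tsum (u := fun k => ‖fc k‖) (fun k => by fun_prop) hs fun k z hz => ?_
    rw [norm_mul, norm_pow]
    exact mul_le_of_le_one_right (norm_nonneg _)
      (pow_le_one₀ (norm_nonneg _) (mem_closedBall_zero_iff.1 hz))
  classical
  set q : ℂ → ℂ := fun z => if z = r then g r else f z / (z - r) ^ (m + 2) with hq
  have hqne : ∀ z : ℂ, z ≠ r → q z = f z / (z - r) ^ (m + 2) := fun z hz => if_neg hz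
  have hqg : ∀ z ∈ Metric.ball (0 : ℂ) 1, q z = g z := fun z hz => by
    by_cases h : z = r
    · simp [hq, h]
    · rw [hqne z h, hf]
      simp only
      rw [hfg z hz, mul_div_cancel_left₀ _ (pow_ne_zero _ (sub_ne_zero.2 h))]
  have hqd : DifferentiableOn ℂ q (Metric.ball 0 1) := hg.congr hqg
  have hqc : ContinuousOn q (Metric.closedBall 0 1) := fun z hz => by
    by_cases h : z = r
    · rw [h]
      exact ((hqd.differentiableAt (Metric.isOpen_ball.mem_nhds hrball)).continuousAt).continuousWithinAt
    · refine ((hfc z hz).div (g := fun z : ℂ => (z - r) ^ (m + 2))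
        (Continuous.continuousWithinAt (by fun_prop))
        (pow_ne_zero _ (sub_ne_zero.2 h))).congr_of_eventuallyEq ?_ (hqne z h)
      filter_upwards [mem_nhdsWithin_of_mem_nhds (isOpen_ne.mem_nhds h)] with w hw using hqne w hw
  set G : ℂ → ℂ := fun z => q z * ((1 - r * z) ^ m * (z ^ 2 - 1)) with hG
  have hcauchy : ∮ z in C(0, 1), (z - 0)⁻¹ • G z = (2 * Real.pi * I) • G 0 := by
    refine circleIntegral_sub_inv_smul_of_differentiable_on_off_countable Set.countable_empty
      (by simp) (hqc.mul (by fun_prop)) fun z hz => ?_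
    exact (hqd.differentiableAt (Metric.isOpen_ball.mem_nhds hz.1)).mul (by fun_prop)
  have hG0 : ‖G 0‖ = 1 := by
    simp only [hG]
    rw [hqne 0 hr0'.symm]
    have : f 0 = fc 0 := by
      simp only [hf]
      rw [tsum_eq_single 0 fun k hk => by simp [hk]]
      simp
    simp [this, h0, abs_of_pos hr0, hr0.ne']
  have hzr : ∀ t : ℝ, exp (t * I) - r ≠ 0 := fun t h => by
    have h1 := norm_exp_ofReal_mul_I t
    rw [sub_eq_zero.1 h, norm_real, Real.norm_eq_abs, abs_of_pos hr0] at h1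
    exact hr1.ne h1
  have hcirc : ∮ z in C(0, 1), (z - 0)⁻¹ • G z =
      I * ∫ t in 0..2 * Real.pi, G (exp (t * I)) := by
    rw [circleIntegral, ← intervalIntegral.integral_const_mul]
    refine intervalIntegral.integral_congr fun t _ => ?_
    simp only [deriv_circleMap, circleMap, ofReal_one, one_mul, zero_add, sub_zero, smul_eq_mul]
    have := exp_ne_zero (t * I)
    field_simp
  have hnorm : ‖∫ t in 0..2 * Real.pi, G (exp (t * I))‖ = 2 * Real.pi := by
    have := congrArg norm (hcirc.symm.trans hcauchy)
    simpa [hG0, abs_of_pos hpi] using this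
  set F : ℕ → ℝ → ℂ := fun k t => fc k * ((exp (t * I) ^ 2 - 1) / (exp (t * I) - r) ^ 2 *
        (exp (t * I) ^ k * ((1 - r * exp (t * I)) / (exp (t * I) - r)) ^ m)) with hF
  set w : ℝ → ℂ := fun t => (exp (t * I) ^ 2 - 1) / (exp (t * I) - r) ^ 2 *
    ((1 - r * exp (t * I)) / (exp (t * I) - r)) ^ m with hw
  have hwc : Continuous w := by
    refine Continuous.mul (Continuous.div (by fun_prop) (by fun_prop) fun t => pow_ne_zero 2 (hzr t)) ?_
    exact (Continuous.div (by fun_prop) (by fun_prop) hzr).pow m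
  have hFw : ∀ k t, F k t = fc k * exp (t * I) ^ k * w t := fun k t => by
    simp only [hF, hw]; ring
  have hsum : HasSum (fun k => ∫ t in 0..2 * Real.pi, F k t)
      (∫ t in 0..2 * Real.pi, G (exp (t * I))) := by
    refine intervalIntegral.hasSum_integral_of_dominated_convergence (fun k t => ‖fc k‖ * ‖w t‖)
      (fun k => ?_) (fun k => ?_) ?_ ?_ ?_
    · simp only [funext (hFw k)]
      exact Continuous.aestronglyMeasurable (by fun_prop)
    · refine Filter.Eventually.of_forall fun t _ => ?_
      rw [hFw, norm_mul, norm_mul, norm_pow, norm_exp_ofReal_mul_I, one_pow, mul_one]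
    · exact Filter.Eventually.of_forall fun t _ => hs.mul_right _
    · simp only [tsum_mul_right]
      exact Continuous.intervalIntegrable (by fun_prop) _ _
    · refine Filter.Eventually.of_forall fun t _ => ?_
      have h1 : Summable fun k => fc k * exp (t * I) ^ k := by
        refine Summable.of_norm ?_
        simpa only [norm_mul, norm_pow, norm_exp_ofReal_mul_I, one_pow, mul_one] using hs
      have h2 : G (exp (t * I)) = f (exp (t * I)) * w t := by
        simp only [hG, hw]
        rw [hqne _ (sub_ne_zero.1 (hzr t))]
        have := hzr t
        rw [div_pow, pow_add]
        field_simp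
      rw [h2, funext fun k => hFw k t]
      exact h1.hasSum.mul_right _
  rw [← hnorm, ← hsum.tsum_eq, ← tsum_mul_left]
  refine tsum_of_norm_bounded (hs.mul_left B).hasSum fun k => ?_
  simp only [hF]
  rw [intervalIntegral.integral_const_mul, norm_mul, mul_comm]
  exact mul_le_mul_of_nonneg_right (hB k) (norm_nonneg _)

theorem le_tsum_norm_succ_of_root {lam : ℂ} (hlam : ‖lam‖ < 1) {fc : ℕ → ℂ}
    (hs : Summable fun k => ‖fc k‖) (hroot : ∑' k, fc k * lam ^ k = 0) :
    ‖fc 0‖ ≤ ∑' k, ‖fc (k + 1)‖ := by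
  have hle : ∀ k, ‖fc k * lam ^ k‖ ≤ ‖fc k‖ := fun k => by
    rw [norm_mul, norm_pow]
    exact mul_le_of_le_one_right (norm_nonneg _) (pow_le_one₀ (norm_nonneg _) hlam.le)
  have hsum : Summable fun k => fc k * lam ^ k := Summable.of_norm_bounded hs hle
  rw [hsum.tsum_eq_zero_add, pow_zero, mul_one] at hroot
  rw [eq_neg_of_add_eq_zero_left hroot, norm_neg]
  exact tsum_of_norm_bounded ((summable_nat_add_iff 1).2 hs).hasSum fun k => hle (k + 1)

/-- For fixed λ ∈ 𝔻∖{0} there is c = c(λ) > 0 such that for every n ≥ 1, every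
function f in the Wiener algebra (given by its absolutely summable coefficient sequence `fc`)
with f(0) = λⁿ and a zero of order at least n at λ (i.e. f(z) = (z−λ)ⁿ·g(z) with g holomorphic
on 𝔻) satisfies ∑_{k≥1} |f̂(k)| ≥ c·√n.  This is the Gluskin–Meyer–Pajor lower bound
φ(λ,…,λ) ≥ c(λ)·√n. -/
theorem gmp_phi_singleton_spectrum_lower_bound
    (lam : ℂ) (hlam : ‖lam‖ < 1) (hlam0 : lam ≠ 0) :
    ∃ c : ℝ, 0 < c ∧ ∀ n : ℕ, 1 ≤ n → ∀ fc : ℕ → ℂ,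
      Summable (fun k : ℕ => ‖fc k‖) →
      fc 0 = lam ^ n →
      (∃ g : ℂ → ℂ, DifferentiableOn ℂ g (Metric.ball (0 : ℂ) 1) ∧
        ∀ z ∈ Metric.ball (0 : ℂ) 1,
          ∑' k : ℕ, fc k * z ^ k = (z - lam) ^ n * g z) →
      c * Real.sqrt n ≤ ∑' k : ℕ, ‖fc (k + 1)‖ := by
  set r : ℝ := ‖lam‖ with hr
  have hr0 : 0 < r := norm_pos_iff.2 hlam0
  have hpi := Real.pi_pos
  obtain ⟨C, hC⟩ := exists_norm_integral_blaschke_le hr0 hlam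
  set C' : ℝ := max C 1
  have hC' : 0 < C' := lt_max_of_lt_right one_pos
  refine ⟨min (r ^ 2 / 2) (Real.pi / (2 * C')), by positivity, ?_⟩
  rintro n hn fc hs h0 ⟨g, hg, hfg⟩
  have hroot : ‖fc 0‖ ≤ ∑' k, ‖fc (k + 1)‖ := by
    refine le_tsum_norm_succ_of_root hlam hs ?_
    rw [hfg lam (mem_ball_zero_iff.2 hlam), sub_self, zero_pow (by omega), zero_mul]
  have hnorm0 : ‖fc 0‖ = r ^ n := by rw [h0, norm_pow]
  obtain hn2 | hn3 := le_or_gt n 2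
  · have h1 : √(n : ℝ) ≤ 2 := by
      rw [Real.sqrt_le_left (by norm_num)]
      have : (n : ℝ) ≤ 2 := by exact_mod_cast hn2
      linarith
    calc _ ≤ r ^ 2 / 2 * 2 := by gcongr; exact min_le_left _ _
      _ = r ^ 2 := by ring
      _ ≤ r ^ n := pow_le_pow_of_le_one hr0.le hlam.le hn2
      _ ≤ _ := hnorm0 ▸ hroot
  · obtain ⟨m, rfl⟩ : ∃ m, n = m + 2 := ⟨n - 2, by omega⟩
    have hm : 0 < m := by omega
    have hm1 : (1 : ℝ) ≤ m := by exact_mod_cast hm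
    set ω : ℂ := lam / r with hω
    have hrC : (r : ℂ) ≠ 0 := by exact_mod_cast hr0.ne'
    have hωr : ω * r = lam := div_mul_cancel₀ _ hrC
    have hω1 : ‖ω‖ = 1 := by
      rw [hω, norm_div, norm_real, Real.norm_eq_abs, abs_of_pos hr0, ← hr, div_self hr0.ne']
    have hnk : ∀ k, ‖fc k * ω ^ k‖ = ‖fc k‖ := fun k => by
      rw [norm_mul, norm_pow, hω1, one_pow, mul_one]
    have hmaps : ∀ z ∈ Metric.ball (0 : ℂ) 1, ω * z ∈ Metric.ball (0 : ℂ) 1 := fun z hz => by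
      rw [mem_ball_zero_iff] at hz ⊢
      rwa [norm_mul, hω1, one_mul]
    have key := two_pi_le_of_dvd_sub_pow hr0 hlam (hC m hm)
      (fc := fun k => fc k * ω ^ k) (g := fun z => ω ^ (m + 2) * g (ω * z))
      (by simpa only [hnk] using hs) (by simp only [hnk, hnorm0])
      ((hg.comp (by fun_prop) hmaps).const_mul _) (fun z hz => by
        have := hfg (ω * z) (hmaps z hz)
        rw [← mul_assoc, ← mul_pow, sub_mul, mul_comm z, mul_comm (r : ℂ), hωr, ← this]
        exact tsum_congr fun k => by ring)
    simp only [hnk] at key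
    rw [hs.tsum_eq_zero_add] at key
    set S := ∑' k, ‖fc (k + 1)‖
    have hS : 0 ≤ S := (norm_nonneg _).trans hroot
    have hsm : 0 < √(m : ℝ) := Real.sqrt_pos.2 (by linarith)
    have h1 : 2 * Real.pi ≤ C' / √m * (2 * S) := by
      refine key.trans ?_
      gcongr
      · exact le_max_left _ _
      · linarith
    have h2 : √((m + 2 : ℕ) : ℝ) ≤ 2 * √(m : ℝ) := by
      rw [Real.sqrt_le_left (by positivity), mul_pow, Real.sq_sqrt (by linarith)]
      push_cast
      linarith
    calc _ ≤ Real.pi / (2 * C') * (2 * √(m : ℝ)) := by gcongr; exact min_le_right _ _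
      _ ≤ S := by
        have h3 : C' / √m * (2 * S) = 2 * (C' * S) / √m := by ring
        rw [h3, le_div_iff₀ hsm] at h1
        have h4 : Real.pi / (2 * C') * (2 * √(m : ℝ)) = Real.pi * √m / C' := by field_simp
        rw [h4, div_le_iff₀ hC']
        linarith
end

section
/- For every fixed λ ∈ 𝔻∖{0} there exists a constant c = c(λ) > 0 such that for every integer n ≥ 1 there exists a norm on ℂⁿ whose induced operator norm ‖·‖ satisfies both ‖T_λ‖ ≤ 1 and |λ|ⁿ·‖T_λ⁻¹‖ ≥ c·√n. In particular |det T_λ|·‖T_λ⁻¹‖ ≥ c·√n·‖T_λ‖^{n−1}, so the matrices T_λ form an explicit counterexample to Schäffer's conjecture. -/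
/-- The lower-triangular Toeplitz matrix `T_λ`: diagonal entries λ, entries
(1 − |λ|²)·(−conj λ)^(i−j−1) below the diagonal, and 0 above the diagonal. -/
noncomputable def ToeplitzTlam (n : ℕ) (lam : ℂ) : Matrix (Fin n) (Fin n) ℂ :=
  fun i j =>
    if (i : ℕ) = (j : ℕ) then lam
    else if (j : ℕ) < (i : ℕ) then
      ((1 - ‖lam‖ ^ 2 : ℝ) : ℂ) * (-(starRingEnd ℂ) lam) ^ ((i : ℕ) - (j : ℕ) - 1)
    else 0

section

open Complex MeasureTheory

lemma norm_integral_oscillatory_le {E a a' : ℝ → ℂ} {v v' : ℝ → ℝ} {α β s K σ : ℝ}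
    (hαβ : α ≤ β) (hs : 0 < s) (hσ : |σ| = 1)
    (hE : ∀ t, HasDerivAt E (I * v t * E t) t) (ha : ∀ t, HasDerivAt a (a' t) t)
    (hv : ∀ t, HasDerivAt v (v' t) t) (ha'c : Continuous a') (hv'c : Continuous v')
    (hE1 : ∀ t, ‖E t‖ = 1) (ha2 : ∀ t, ‖a t‖ ≤ 2) (ha'2 : ∀ t, ‖a' t‖ ≤ 2)
    (hmono : ∀ t ∈ Set.Icc α β, |v' t| = σ * v' t)
    (hK : ∀ t, s ^ 2 * ‖a t‖ ≤ K * |v' t| + |v t| * ‖a t‖)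
    (haα : a α = 0) (haβ : a β = 0) (hK0 : 0 ≤ K) :
    ‖∫ t in α..β, E t * a t‖ ≤ ((K + 2) * Real.pi + 2 * (β - α)) / s := by
  have hEc : Continuous E := continuous_iff_continuousAt.2 fun t => (hE t).continuousAt
  have hac : Continuous a := continuous_iff_continuousAt.2 fun t => (ha t).continuousAt
  have hvc : Continuous v := continuous_iff_continuousAt.2 fun t => (hv t).continuousAt
  have hD : ∀ t, 0 < v t ^ 2 + s ^ 2 := fun t => by positivity
  set q : ℝ → ℝ := fun t => v t / (v t ^ 2 + s ^ 2) with hq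
  set q' : ℝ → ℝ := fun t => v' t * (s ^ 2 - v t ^ 2) / (v t ^ 2 + s ^ 2) ^ 2 with hq'
  have hqd : ∀ t, HasDerivAt q (q' t) t := by
    intro t
    have := (hv t).div (((hv t).pow 2).add_const (s ^ 2)) (hD t).ne'
    refine this.congr_deriv ?_
    change _ = v' t * (s ^ 2 - v t ^ 2) / (v t ^ 2 + s ^ 2) ^ 2
    congr 1
    norm_num
    ring
  have hqc : Continuous q := continuous_iff_continuousAt.2 fun t => (hqd t).continuousAt
  have hq'c : Continuous q' := by
    simp only [hq']
    exact Continuous.div (by fun_prop) (by fun_prop) fun t => (pow_pos (hD t) 2).ne'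
  set R : ℝ → ℂ := fun t =>
    E t * a t * (1 - v t * q t : ℝ) + I * E t * (a' t * q t + a t * q' t) with hR
  have hG : ∀ t, HasDerivAt (fun t => -I * (E t * a t * (q t : ℂ)))
      (E t * a t - R t) t := by
    intro t
    refine ((((hE t).mul (ha t)).mul (hqd t).ofReal_comp).const_mul (-I)).congr_deriv ?_
    change _ = E t * a t - (E t * a t * (1 - v t * q t : ℝ) + I * E t * (a' t * q t + a t * q' t))
    simp only [Pi.mul_apply]
    push_cast
    linear_combination -(E t * a t * v t * q t) * I_sq
  have hRc : Continuous R := by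
    simp only [hR]
    fun_prop
  have hint : ∫ t in α..β, (E t * a t - R t) = 0 := by
    rw [intervalIntegral.integral_eq_sub_of_hasDerivAt (fun t _ => hG t)
      ((by fun_prop : Continuous fun t => E t * a t - R t).intervalIntegrable _ _)]
    simp [haα, haβ]
  rw [intervalIntegral.integral_sub (f := fun t => E t * a t) ((hEc.mul hac).intervalIntegrable _ _)
    (hRc.intervalIntegrable _ _), sub_eq_zero] at hint
  rw [hint]
  set b : ℝ → ℝ := fun t => (K + 2) * (σ * v' t / (v t ^ 2 + s ^ 2)) + 2 / s with hb
  have hbc : Continuous b := by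
    simp only [hb]
    exact (continuous_const.mul (Continuous.div (by fun_prop) (by fun_prop)
      fun t => (hD t).ne')).add continuous_const
  have hB : ∀ t, HasDerivAt (fun t => (K + 2) * (σ * Real.arctan (v t / s) / s) + 2 / s * t)
      (b t) t := by
    intro t
    have h1 := ((hv t).div_const s).arctan
    have h2 := (((h1.const_mul σ).div_const s).const_mul (K + 2)).add
      ((hasDerivAt_id t).const_mul (2 / s))
    refine h2.congr_deriv ?_
    simp only [hb]
    have := (hD t).ne'
    have : 1 + (v t / s) ^ 2 ≠ 0 := by positivity
    field_simp
    ring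
  have hRb : ∀ t ∈ Set.Icc α β, ‖R t‖ ≤ b t := by
    intro t ht
    have hDt := hD t
    have h1 : 1 - v t * q t = s ^ 2 / (v t ^ 2 + s ^ 2) := by
      simp only [hq]; field_simp; ring
    have hqb : |v t| / (v t ^ 2 + s ^ 2) ≤ 1 / (2 * s) := by
      rw [div_le_div_iff₀ hDt (by positivity)]
      nlinarith [sq_nonneg (|v t| - s), sq_abs (v t)]
    have hqb' : |q t| ≤ 1 / (2 * s) := by
      simpa only [hq, abs_div, abs_of_pos hDt] using hqb
    have hq'b : |q' t| ≤ |v' t| / (v t ^ 2 + s ^ 2) := by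
      simp only [hq']
      rw [abs_div, abs_mul, abs_of_pos (pow_pos hDt 2), div_le_div_iff₀ (pow_pos hDt 2) hDt]
      have : |s ^ 2 - v t ^ 2| ≤ v t ^ 2 + s ^ 2 := by
        rw [abs_le]; constructor <;> nlinarith [sq_nonneg s, sq_nonneg (v t)]
      calc |v' t| * |s ^ 2 - v t ^ 2| * (v t ^ 2 + s ^ 2)
          ≤ |v' t| * (v t ^ 2 + s ^ 2) * (v t ^ 2 + s ^ 2) := by gcongr
        _ = _ := by ring
    have hmain : ‖a t‖ * (s ^ 2 / (v t ^ 2 + s ^ 2))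
        ≤ K * (|v' t| / (v t ^ 2 + s ^ 2)) + 1 / s := by
      calc ‖a t‖ * (s ^ 2 / (v t ^ 2 + s ^ 2)) = (s ^ 2 * ‖a t‖) / (v t ^ 2 + s ^ 2) := by ring
        _ ≤ (K * |v' t| + |v t| * ‖a t‖) / (v t ^ 2 + s ^ 2) := by gcongr; exact hK t
        _ = K * (|v' t| / (v t ^ 2 + s ^ 2)) + |v t| / (v t ^ 2 + s ^ 2) * ‖a t‖ := by ring
        _ ≤ K * (|v' t| / (v t ^ 2 + s ^ 2)) + 1 / (2 * s) * 2 := by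
          gcongr; exact ha2 t
        _ = _ := by field_simp
    have hs2 : 0 ≤ s ^ 2 / (v t ^ 2 + s ^ 2) := by positivity
    calc ‖R t‖ ≤ ‖E t * a t * (1 - v t * q t : ℝ)‖ + ‖I * E t * (a' t * q t + a t * q' t)‖ :=
          norm_add_le _ _
      _ ≤ ‖a t‖ * (s ^ 2 / (v t ^ 2 + s ^ 2)) + (‖a' t‖ * |q t| + ‖a t‖ * |q' t|) := by
          rw [h1]
          refine add_le_add ?_ ?_
          · simp only [norm_mul, hE1, one_mul, norm_real, Real.norm_eq_abs, abs_of_nonneg hs2]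
            exact le_rfl
          · rw [norm_mul, norm_mul, hE1, norm_I, one_mul, one_mul]
            refine (norm_add_le _ _).trans (le_of_eq ?_)
            simp
      _ ≤ (K * (|v' t| / (v t ^ 2 + s ^ 2)) + 1 / s)
          + (2 * (1 / (2 * s)) + 2 * (|v' t| / (v t ^ 2 + s ^ 2))) := by
          gcongr
          · exact ha'2 t
          · exact ha2 t
      _ = b t := by
          simp only [hb]
          rw [hmono t ht]
          field_simp
          ring
  have hσarc : ∀ x y : ℝ, σ * Real.arctan x - σ * Real.arctan y ≤ Real.pi := by
    intro x y
    rw [← mul_sub]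
    refine (le_abs_self _).trans ?_
    rw [abs_mul, hσ, one_mul, abs_le]
    constructor <;> linarith [Real.arctan_lt_pi_div_two x, Real.arctan_lt_pi_div_two y,
      Real.neg_pi_div_two_lt_arctan x, Real.neg_pi_div_two_lt_arctan y]
  calc ‖∫ t in α..β, R t‖ ≤ ∫ t in α..β, b t :=
        intervalIntegral.norm_integral_le_of_norm_le hαβ
          (Filter.Eventually.of_forall fun t ht => hRb t ⟨ht.1.le, ht.2⟩)
          (hbc.intervalIntegrable _ _)
    _ = ((K + 2) * (σ * Real.arctan (v β / s) - σ * Real.arctan (v α / s))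
          + 2 * (β - α)) / s := by
        rw [intervalIntegral.integral_eq_sub_of_hasDerivAt (fun t _ => hB t)
          (hbc.intervalIntegrable _ _)]
        ring
    _ ≤ _ := by
        gcongr
        exact hσarc _ _

/-- The Blaschke factor `z ↦ (z + r) / (1 + r z)` with zero at the real point `-r`. -/
noncomputable def blaschke (r : ℝ) (z : ℂ) : ℂ := (z + r) / (1 + r * z)

lemma one_add_real_mul_ne_zero {r : ℝ} (hr0 : 0 < r) (hr1 : r < 1) {z : ℂ} (hz : ‖z‖ ≤ 1) :
    1 + r * z ≠ 0 := by
  intro h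
  have h1 : ‖(r : ℂ) * z‖ = 1 := by
    rw [show (r : ℂ) * z = -1 by linear_combination h]; simp
  rw [norm_mul, norm_real, Real.norm_eq_abs, abs_of_pos hr0] at h1
  nlinarith [norm_nonneg z]

lemma circleMap_mul_circleMap_neg (t : ℝ) : circleMap 0 1 t * circleMap 0 1 (-t) = 1 := by
  simp [circleMap, ← Complex.exp_add]

lemma circleMap_zero_one_eq (t : ℝ) : circleMap 0 1 t = Real.cos t + Real.sin t * I := by
  simp [circleMap, Complex.exp_mul_I]

lemma conj_circleMap_zero_one (t : ℝ) :
    (starRingEnd ℂ) (circleMap 0 1 t) = (circleMap 0 1 t)⁻¹ := by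
  rw [Complex.inv_def, Complex.normSq_eq_norm_sq]
  simp

lemma norm_blaschke_circleMap {r : ℝ} (hr0 : 0 < r) (hr1 : r < 1) (t : ℝ) :
    ‖blaschke r (circleMap 0 1 t)‖ = 1 := by
  have hz : ‖circleMap 0 1 t‖ = 1 := by simp
  have hne := one_add_real_mul_ne_zero hr0 hr1 hz.le
  have hz0 : circleMap 0 1 t ≠ 0 := by rw [← norm_pos_iff, hz]; norm_num
  rw [blaschke, norm_div, div_eq_one_iff_eq (norm_ne_zero_iff.2 hne)]
  have : (starRingEnd ℂ) (circleMap 0 1 t + r) * circleMap 0 1 t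
      = 1 + r * circleMap 0 1 t := by
    rw [map_add, conj_circleMap_zero_one, conj_ofReal]
    field_simp
  rw [← this, norm_mul, hz, mul_one, RCLike.norm_conj]

lemma differentiableAt_blaschke {r : ℝ} (hr0 : 0 < r) (hr1 : r < 1) {z : ℂ} (hz : ‖z‖ ≤ 1) :
    DifferentiableAt ℂ (blaschke r) z := by
  unfold blaschke
  exact DifferentiableAt.div (by fun_prop) (by fun_prop) (one_add_real_mul_ne_zero hr0 hr1 hz)

lemma HasDerivAt.pow_of_log_deriv {f : ℝ → ℂ} {c : ℂ} {t : ℝ} (h : HasDerivAt f (c * f t) t)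
    (k : ℕ) : HasDerivAt (fun t => f t ^ k) (k * c * f t ^ k) t := by
  refine (h.pow k).congr_deriv ?_
  cases k with
  | zero => simp
  | succ k => simp only [Nat.add_sub_cancel]; ring

lemma norm_one_sub_circleMap_sq (t : ℝ) : ‖1 - circleMap 0 1 t ^ 2‖ = 2 * |Real.sin t| := by
  have h : 1 - circleMap 0 1 t ^ 2 = -2 * I * (Real.sin t : ℝ) * circleMap 0 1 t := by
    rw [circleMap_zero_one_eq]
    have : (Real.sin t : ℂ) ^ 2 + (Real.cos t : ℂ) ^ 2 = 1 := by
      exact_mod_cast Real.sin_sq_add_cos_sq t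
    linear_combination (Real.sin t : ℂ) ^ 2 * I_sq - this
  rw [h]
  simp only [norm_mul, norm_neg, norm_I, norm_real, Real.norm_eq_abs, norm_circleMap_zero]
  simp

/-- The angular derivative of `blaschke r` on the unit circle is `(1 - r²)/(1 + 2 r cos t + r²)`. -/
lemma hasDerivAt_blaschke_circleMap {r : ℝ} (hr0 : 0 < r) (hr1 : r < 1) (t : ℝ) :
    HasDerivAt (fun t => blaschke r (circleMap 0 1 t))
      (I * ((1 - r ^ 2) / (1 + 2 * r * Real.cos t + r ^ 2) : ℝ)
        * blaschke r (circleMap 0 1 t)) t := by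
  have hz : ‖circleMap 0 1 t‖ = 1 := by simp
  have hne := one_add_real_mul_ne_zero hr0 hr1 hz.le
  have hc := hasDerivAt_circleMap 0 1 t
  have h := (hc.add_const (r : ℂ)).div ((hc.const_mul (r : ℂ)).const_add 1) hne
  refine h.congr_deriv ?_
  have hz' : ‖circleMap 0 1 (-t)‖ = 1 := by simp
  have hne' := one_add_real_mul_ne_zero hr0 hr1 hz'.le
  have hm := circleMap_mul_circleMap_neg t
  have hQ : ((1 + 2 * r * Real.cos t + r ^ 2 : ℝ) : ℂ)
      = (1 + r * circleMap 0 1 t) * (1 + r * circleMap 0 1 (-t)) := by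
    have h2 : circleMap 0 1 t + circleMap 0 1 (-t) = 2 * (Real.cos t : ℝ) := by
      rw [circleMap_zero_one_eq, circleMap_zero_one_eq, Real.cos_neg, Real.sin_neg]
      push_cast; ring
    push_cast at h2 ⊢
    linear_combination -(r : ℂ) * h2 - (r : ℂ) ^ 2 * hm
  rw [blaschke, ofReal_div, hQ]
  push_cast
  rw [← mul_div_assoc I, div_mul_div_comm,
    div_eq_div_iff (pow_ne_zero 2 hne) (mul_ne_zero (mul_ne_zero hne hne') hne)]
  linear_combination (I * (1 - r ^ 2) * r * (1 + r * circleMap 0 1 t) ^ 2) * hm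

/-- The Fourier coefficients of `blaschke r ^ k * (1 - z ^ 2)` decay like `m ^ (-1/2)`, uniformly
in `k`: the factor `1 - z ^ 2` vanishes at the degenerate stationary points. -/
lemma norm_circleAverage_blaschke_pow_le {r : ℝ} (hr0 : 0 < r) (hr1 : r < 1) (k : ℕ) {m : ℕ}
    (hm : 0 < m) :
    ‖Real.circleAverage (fun z => blaschke r z ^ k * (1 - z ^ 2) * z⁻¹ ^ m) 0 1‖
      ≤ (4 / r + 4) / Real.sqrt m := by
  have hs : 0 < Real.sqrt m := Real.sqrt_pos.2 (by exact_mod_cast hm)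
  set Q : ℝ → ℝ := fun t => 1 + 2 * r * Real.cos t + r ^ 2 with hQ
  have hQpos : ∀ t, 0 < Q t := fun t => by
    simp only [hQ]; nlinarith [Real.neg_one_le_cos t, sq_nonneg (1 - r), mul_pos hr0 hr0]
  have hQ4 : ∀ t, Q t ≤ 4 := fun t => by
    simp only [hQ]; nlinarith [Real.cos_le_one t]
  set E : ℝ → ℂ := fun t => blaschke r (circleMap 0 1 t) ^ k * (circleMap 0 1 t)⁻¹ ^ m with hE
  set v : ℝ → ℝ := fun t => k * ((1 - r ^ 2) / Q t) - m with hv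
  set v' : ℝ → ℝ := fun t => k * ((1 - r ^ 2) * (2 * r * Real.sin t) / Q t ^ 2) with hv'
  set a : ℝ → ℂ := fun t => 1 - circleMap 0 1 t ^ 2 with ha
  set a' : ℝ → ℂ := fun t => -(2 * I * circleMap 0 1 t ^ 2) with ha'
  have hz0 : ∀ t, circleMap 0 1 t ≠ 0 := fun t => by
    rw [← norm_pos_iff]; simp
  have hEd : ∀ t, HasDerivAt E (I * v t * E t) t := by
    intro t
    have h1 := (hasDerivAt_blaschke_circleMap hr0 hr1 t).pow_of_log_deriv k
    have h2 : HasDerivAt (fun t => (circleMap 0 1 t)⁻¹) (-I * (circleMap 0 1 t)⁻¹) t := by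
      refine ((hasDerivAt_circleMap 0 1 t).inv (hz0 t)).congr_deriv ?_
      have := hz0 t
      field_simp
    refine (h1.mul (h2.pow_of_log_deriv m)).congr_deriv ?_
    simp only [hv, hE, hQ]
    push_cast
    ring
  have had : ∀ t, HasDerivAt a (a' t) t := by
    intro t
    refine (((hasDerivAt_circleMap 0 1 t).pow 2).const_sub 1).congr_deriv ?_
    simp only [ha']
    push_cast
    ring
  have hvd : ∀ t, HasDerivAt v (v' t) t := by
    intro t
    have h1 : HasDerivAt Q (-(2 * r * Real.sin t)) t := by
      refine ((((Real.hasDerivAt_cos t).const_mul (2 * r)).const_add 1).add_const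
        (r ^ 2)).congr_deriv ?_
      ring
    refine ((((hasDerivAt_const t (1 - r ^ 2)).div h1 (hQpos t).ne').const_mul
      (k : ℝ)).sub_const (m : ℝ)).congr_deriv ?_
    simp only [hv']
    ring
  have hv'c : Continuous v' := by
    simp only [hv', hQ]
    exact continuous_const.mul (Continuous.div (by fun_prop) (by fun_prop)
      fun t => (pow_pos (hQpos t) 2).ne')
  have ha'c : Continuous a' := by
    simp only [ha']
    fun_prop
  have hE1 : ∀ t, ‖E t‖ = 1 := fun t => by
    simp [hE, norm_blaschke_circleMap hr0 hr1]
  have haS : ∀ t, ‖a t‖ = 2 * |Real.sin t| := norm_one_sub_circleMap_sq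
  have ha2 : ∀ t, ‖a t‖ ≤ 2 := fun t => by
    rw [haS]; linarith [Real.abs_sin_le_one t]
  have ha'2 : ∀ t, ‖a' t‖ ≤ 2 := fun t => by simp [ha']
  have hc0 : 0 < 1 - r ^ 2 := by nlinarith
  have hv'abs : ∀ t, |v' t| = k * ((1 - r ^ 2) * (2 * r) / Q t ^ 2) * |Real.sin t| := by
    intro t
    have : v' t = k * ((1 - r ^ 2) * (2 * r) / Q t ^ 2) * Real.sin t := by
      simp only [hv']; ring
    rw [this, abs_mul, abs_of_nonneg]
    have := hQpos t
    positivity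
  have hK : ∀ t, Real.sqrt m ^ 2 * ‖a t‖ ≤ 4 / r * |v' t| + |v t| * ‖a t‖ := by
    intro t
    rw [Real.sq_sqrt (Nat.cast_nonneg m)]
    have hq := hQpos t
    have h1 : (m : ℝ) ≤ k * ((1 - r ^ 2) / Q t) + |v t| := by
      have : (m : ℝ) = k * ((1 - r ^ 2) / Q t) - v t := by simp only [hv]; ring
      linarith [neg_abs_le (v t)]
    have h2 : k * ((1 - r ^ 2) / Q t) * ‖a t‖ ≤ 4 / r * |v' t| := by
      rw [hv'abs, haS]
      calc k * ((1 - r ^ 2) / Q t) * (2 * |Real.sin t|)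
          = k * ((1 - r ^ 2) / Q t ^ 2) * (2 * |Real.sin t|) * Q t := by
            field_simp
        _ ≤ k * ((1 - r ^ 2) / Q t ^ 2) * (2 * |Real.sin t|) * 4 := by
            gcongr; exact hQ4 t
        _ = _ := by field_simp
    nlinarith [norm_nonneg (a t)]
  have haz : a 0 = 0 ∧ a Real.pi = 0 ∧ a (2 * Real.pi) = 0 := by
    refine ⟨?_, ?_, ?_⟩ <;> rw [← norm_eq_zero, haS] <;> simp
  have hK0 : 0 ≤ 4 / r := by positivity
  have hpi := Real.pi_pos
  have hEc : Continuous fun t => E t * a t := continuous_iff_continuousAt.2 fun t =>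
    ((hEd t).mul (had t)).continuousAt
  have hI1 : ‖∫ t in (0 : ℝ)..Real.pi, E t * a t‖
      ≤ ((4 / r + 2) * Real.pi + 2 * (Real.pi - 0)) / Real.sqrt m := by
    refine norm_integral_oscillatory_le (σ := 1) hpi.le hs (by simp) hEd had hvd ha'c hv'c hE1 ha2
      ha'2 (fun t ht => ?_) hK haz.1 haz.2.1 hK0
    rw [hv'abs, abs_of_nonneg (Real.sin_nonneg_of_mem_Icc ht)]
    simp only [hv']
    ring
  have hI2 : ‖∫ t in Real.pi..(2 * Real.pi), E t * a t‖
      ≤ ((4 / r + 2) * Real.pi + 2 * (2 * Real.pi - Real.pi)) / Real.sqrt m := by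
    refine norm_integral_oscillatory_le (σ := -1) (by linarith) hs (by simp) hEd had hvd ha'c hv'c
      hE1 ha2 ha'2 (fun t ht => ?_) hK haz.2.1 haz.2.2 hK0
    have : Real.sin t ≤ 0 := by
      have := Real.sin_nonneg_of_nonneg_of_le_pi (x := t - Real.pi) (by linarith [ht.1])
        (by linarith [ht.2])
      rw [Real.sin_sub_pi] at this
      linarith
    rw [hv'abs, abs_of_nonpos this]
    simp only [hv']
    ring
  have hsum : Real.circleAverage (fun z => blaschke r z ^ k * (1 - z ^ 2) * z⁻¹ ^ m) 0 1
      = (2 * Real.pi)⁻¹ • ((∫ t in (0 : ℝ)..Real.pi, E t * a t)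
        + ∫ t in Real.pi..(2 * Real.pi), E t * a t) := by
    rw [Real.circleAverage_def, intervalIntegral.integral_add_adjacent_intervals
      (hEc.intervalIntegrable _ _) (hEc.intervalIntegrable _ _)]
    congr 2
    ext t
    simp only [hE, ha]
    ring
  rw [hsum, norm_smul, Real.norm_eq_abs, abs_of_pos (by positivity)]
  calc (2 * Real.pi)⁻¹ * _ ≤ (2 * Real.pi)⁻¹ *
        (((4 / r + 2) * Real.pi + 2 * (Real.pi - 0)) / Real.sqrt m
          + ((4 / r + 2) * Real.pi + 2 * (2 * Real.pi - Real.pi)) / Real.sqrt m) := by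
        gcongr
        exact (norm_add_le _ _).trans (add_le_add hI1 hI2)
    _ = _ := by field_simp; ring

lemma circleAverage_pow_mul_inv_pow (i j : ℕ) :
    Real.circleAverage (fun z : ℂ => z ^ i * z⁻¹ ^ j) 0 1 = if i = j then 1 else 0 := by
  have key : ∀ p : ℕ, Real.circleAverage (fun z : ℂ => z ^ p) 0 1 = 0 ^ p := fun p =>
    DiffContOnCl.circleAverage (f := fun z : ℂ => z ^ p)
      (by fun_prop : Differentiable ℂ fun z : ℂ => z ^ p).diffContOnCl
  have hz0 : ∀ z ∈ Metric.sphere (0 : ℂ) |1|, z ≠ 0 := by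
    intro z hz h
    simp [h] at hz
  rcases le_or_gt j i with h | h
  · obtain ⟨p, rfl⟩ := Nat.exists_eq_add_of_le h
    rw [Real.circleAverage_congr_sphere (f₂ := fun z => z ^ p), key]
    · rcases Nat.eq_zero_or_pos p with rfl | hp
      · simp
      · simp [hp.ne']
    · intro z hz
      have := hz0 z hz
      simp only [pow_add, inv_pow]
      field_simp
  · obtain ⟨p, rfl⟩ := Nat.exists_eq_add_of_le h.le
    have hp : p ≠ 0 := by omega
    rw [Real.circleAverage_congr_sphere (f₂ := fun z => z⁻¹ ^ p),
      Real.circleAverage_zero_one_congr_inv (f := fun z : ℂ => z ^ p), key]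
    · simp [hp]
    · intro z hz
      have := hz0 z hz
      simp only [pow_add, inv_pow]
      field_simp

lemma norm_circleAverage_le_of_norm_le {f : ℂ → ℂ} {C : ℝ}
    (h : ∀ t, ‖f (circleMap 0 1 t)‖ ≤ C) : ‖Real.circleAverage f 0 1‖ ≤ C := by
  have hpi := Real.pi_pos
  rw [Real.circleAverage_def, norm_smul, Real.norm_eq_abs, abs_of_pos (by positivity),
    inv_mul_le_iff₀ (by positivity)]
  refine (intervalIntegral.norm_integral_le_of_norm_le_const fun t _ => h t).trans (le_of_eq ?_)
  rw [sub_zero, abs_of_pos (by positivity)]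
  ring

section FourierCoefficients

variable {r : ℝ} {X : ℂ → ℂ}

lemma circleAverage_blaschke_pow_zero (hr0 : 0 < r) (hr1 : r < 1) (hX : Differentiable ℂ X)
    (k : ℕ) :
    Real.circleAverage (fun z => blaschke r z ^ k * X z * z⁻¹ ^ 0) 0 1 = r ^ k * X 0 := by
  have hd : DifferentiableOn ℂ (fun z => blaschke r z ^ k * X z * z⁻¹ ^ 0)
      (Metric.closedBall 0 1) := by
    intro z hz
    simp only [pow_zero, mul_one]
    exact (((differentiableAt_blaschke hr0 hr1 (by simpa using hz)).pow k).mul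
      (hX z)).differentiableWithinAt
  rw [DiffContOnCl.circleAverage]
  · simp [blaschke]
  · rw [abs_one]
    exact hd.diffContOnCl_ball subset_rfl

lemma circleIntegrable_blaschke_pow (hr0 : 0 < r) (hr1 : r < 1) (hX : Differentiable ℂ X)
    (k j : ℕ) : CircleIntegrable (fun z => blaschke r z ^ k * X z * z⁻¹ ^ j) 0 1 := by
  refine ContinuousOn.circleIntegrable zero_le_one fun z hz => ContinuousAt.continuousWithinAt ?_
  have hz1 : ‖z‖ = 1 := by simpa using hz
  have hz0 : z ≠ 0 := by rw [← norm_pos_iff, hz1]; norm_num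
  exact (((differentiableAt_blaschke hr0 hr1 hz1.le).continuousAt.pow k).mul
    (hX z).continuousAt).mul ((continuousAt_inv₀ hz0).pow j)

lemma circleAverage_blaschke_pow_succ (hr0 : 0 < r) (hr1 : r < 1) (hX : Differentiable ℂ X)
    (k j : ℕ) :
    Real.circleAverage (fun z => blaschke r z ^ (k + 1) * X z * z⁻¹ ^ (j + 1)) 0 1
        + r * Real.circleAverage (fun z => blaschke r z ^ (k + 1) * X z * z⁻¹ ^ j) 0 1
      = Real.circleAverage (fun z => blaschke r z ^ k * X z * z⁻¹ ^ j) 0 1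
        + r * Real.circleAverage (fun z => blaschke r z ^ k * X z * z⁻¹ ^ (j + 1)) 0 1 := by
  have hI := circleIntegrable_blaschke_pow hr0 hr1 hX
  simp only [← smul_eq_mul (r : ℂ), ← Real.circleAverage_fun_smul]
  have hI' : ∀ k j : ℕ,
      CircleIntegrable (fun z => (r : ℂ) • (blaschke r z ^ k * X z * z⁻¹ ^ j)) 0 1 :=
    fun k j => (hI k j).const_smul
  rw [← Real.circleAverage_fun_add (hI _ _) (hI' _ _),
    ← Real.circleAverage_fun_add (hI _ _) (hI' _ _)]
  refine Real.circleAverage_congr_sphere fun z hz => ?_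
  have hz1 : ‖z‖ = 1 := by simpa using hz
  have hz0 : z ≠ 0 := by rw [← norm_pos_iff, hz1]; norm_num
  have hne := one_add_real_mul_ne_zero hr0 hr1 hz1.le
  have hb : blaschke r z * (1 + r * z) = z + r := div_mul_cancel₀ _ hne
  have hzi : z⁻¹ * z = 1 := inv_mul_cancel₀ hz0
  simp only [smul_eq_mul, pow_succ]
  linear_combination (blaschke r z ^ k * X z * z⁻¹ ^ j * z⁻¹) * hb
    + blaschke r z ^ k * X z * z⁻¹ ^ j * (1 - r * blaschke r z) * hzi

end FourierCoefficients

section Toeplitz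

variable {n : ℕ} {lam : ℂ}

lemma toeplitzTlam_mulVec_zero (x : Fin n → ℂ) (h : 0 < n) :
    (ToeplitzTlam n lam).mulVec x ⟨0, h⟩ = lam * x ⟨0, h⟩ := by
  rw [Matrix.mulVec, dotProduct, Finset.sum_eq_single ⟨0, h⟩]
  · simp [ToeplitzTlam]
  · intro i _ hi
    have : ¬ 0 = (i : ℕ) := fun h0 => hi (Fin.ext h0.symm)
    simp [ToeplitzTlam, this]
  · simp

/-- `T_λ` satisfies `(1 + conj λ S) T_λ = S + λ`, where `S` is the lower shift. -/
lemma toeplitzTlam_mulVec_succ (x : Fin n → ℂ) (j : ℕ) (h : j + 1 < n) :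
    (ToeplitzTlam n lam).mulVec x ⟨j + 1, h⟩
        + (starRingEnd ℂ) lam * (ToeplitzTlam n lam).mulVec x ⟨j, by omega⟩
      = x ⟨j, by omega⟩ + lam * x ⟨j + 1, h⟩ := by
  have hnorm : ((‖lam‖ ^ 2 : ℝ) : ℂ) = (starRingEnd ℂ) lam * lam := by
    rw [mul_comm, Complex.mul_conj, Complex.normSq_eq_norm_sq]
  have hentry : ∀ i : Fin n, ToeplitzTlam n lam ⟨j + 1, h⟩ i
      + (starRingEnd ℂ) lam * ToeplitzTlam n lam ⟨j, by omega⟩ i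
      = (if i = ⟨j, by omega⟩ then 1 else 0) + (if i = ⟨j + 1, h⟩ then lam else 0) := by
    intro i
    have e1 : i = ⟨j, by omega⟩ ↔ (i : ℕ) = j := Fin.ext_iff
    have e2 : i = ⟨j + 1, h⟩ ↔ (i : ℕ) = j + 1 := Fin.ext_iff
    simp only [ToeplitzTlam, e1, e2, ofReal_sub, ofReal_one, hnorm]
    rcases lt_trichotomy (i : ℕ) j with hi | hi | hi
    · obtain ⟨p, rfl⟩ := Nat.exists_eq_add_of_lt hi
      rw [if_neg (by omega), if_pos (by omega), if_neg (by omega), if_pos (by omega),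
        if_neg (by omega), if_neg (by omega),
        show (i : ℕ) + p + 1 + 1 - i - 1 = p + 1 by omega,
        show (i : ℕ) + p + 1 - i - 1 = p by omega, pow_succ]
      ring
    · rw [if_neg (by omega), if_pos (by omega), if_pos hi.symm, if_pos hi, if_neg (by omega),
        show j + 1 - (i : ℕ) - 1 = 0 by omega]
      ring
    · rcases Nat.lt_or_ge (j + 1) i with hi' | hi'
      · rw [if_neg (by omega), if_neg (by omega), if_neg (by omega), if_neg (by omega),
          if_neg (by omega), if_neg (by omega)]
        ring
      · rw [if_pos (by omega), if_neg (by omega), if_neg (by omega), if_neg (by omega),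
          if_pos (by omega)]
        ring
  simp only [Matrix.mulVec, dotProduct, Finset.mul_sum]
  rw [← Finset.sum_add_distrib]
  calc _ = ∑ i : Fin n, ((if i = ⟨j, by omega⟩ then 1 else 0)
        + (if i = ⟨j + 1, h⟩ then lam else 0)) * x i := by
        refine Finset.sum_congr rfl fun i _ => ?_
        rw [← hentry i]
        ring
    _ = _ := by
        simp [add_mul, Finset.sum_add_distrib]

lemma toeplitzTlam_det : (ToeplitzTlam n lam).det = lam ^ n := by
  rw [Matrix.det_of_isLowerTriangular]
  · simp [ToeplitzTlam]
  · intro i j hij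
    have hij : (i : ℕ) < j := hij
    simp only [ToeplitzTlam]
    rw [if_neg (by omega), if_neg (by omega)]

/-- After the rotation `λ = r u`, the entries of `T_λ ^ k x` are the Fourier coefficients of
`blaschke r ^ k` times the polynomial with coefficients `u ^ i x i`. -/
lemma toeplitzTlam_pow_mulVec {r : ℝ} {u : ℂ} (hr0 : 0 < r) (hr1 : r < 1) (hlam : lam = r * u)
    (hconj : (starRingEnd ℂ) lam * u = r) (x : Fin n → ℂ) (k j : ℕ) (hj : j < n) :
    u ^ j * ((ToeplitzTlam n lam) ^ k).mulVec x ⟨j, hj⟩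
      = u ^ k * Real.circleAverage
        (fun z => blaschke r z ^ k * (∑ i : Fin n, u ^ (i : ℕ) * x i * z ^ (i : ℕ)) * z⁻¹ ^ j)
        0 1 := by
  have hX : Differentiable ℂ fun z => ∑ i : Fin n, u ^ (i : ℕ) * x i * z ^ (i : ℕ) := by fun_prop
  induction k generalizing j with
  | zero =>
    have hI : ∀ i ∈ (Finset.univ : Finset (Fin n)),
        CircleIntegrable (fun z : ℂ => (u ^ (i : ℕ) * x i) • (z ^ (i : ℕ) * z⁻¹ ^ j)) 0 1 := by
      intro i _
      refine CircleIntegrable.const_smul ?_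
      have := circleIntegrable_blaschke_pow hr0 hr1
        (by fun_prop : Differentiable ℂ fun z : ℂ => z ^ (i : ℕ)) 0 j
      simpa using this
    have : (fun z : ℂ =>
          blaschke r z ^ 0 * (∑ i : Fin n, u ^ (i : ℕ) * x i * z ^ (i : ℕ)) * z⁻¹ ^ j)
        = fun z => ∑ i : Fin n, (u ^ (i : ℕ) * x i) • (z ^ (i : ℕ) * z⁻¹ ^ j) := by
      ext z
      rw [pow_zero, one_mul, Finset.sum_mul]
      exact Finset.sum_congr rfl fun i _ => by rw [smul_eq_mul]; ring
    rw [this, Real.circleAverage_fun_sum hI]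
    simp only [Real.circleAverage_fun_smul, circleAverage_pow_mul_inv_pow]
    rw [Finset.sum_eq_single ⟨j, hj⟩]
    · simp
    · intro i _ hi
      have : ¬ (i : ℕ) = j := fun h0 => hi (Fin.ext h0)
      simp [this]
    · simp
  | succ k ih =>
    have hstep : ((ToeplitzTlam n lam) ^ (k + 1)).mulVec x
        = (ToeplitzTlam n lam).mulVec (((ToeplitzTlam n lam) ^ k).mulVec x) := by
      rw [Matrix.mulVec_mulVec, pow_succ']
    rw [hstep]
    induction j with
    | zero =>
      have h0 := ih 0 hj
      rw [toeplitzTlam_mulVec_zero, circleAverage_blaschke_pow_zero hr0 hr1 hX]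
      rw [circleAverage_blaschke_pow_zero hr0 hr1 hX] at h0
      rw [hlam] at h0 ⊢
      linear_combination (r * u) * h0
    | succ j ihj =>
      have h1 := toeplitzTlam_mulVec_succ (lam := lam)
        (((ToeplitzTlam n lam) ^ k).mulVec x) j hj
      have h2 := ihj (by omega)
      have h3 := circleAverage_blaschke_pow_succ hr0 hr1 hX k j
      have h4 := ih j (by omega)
      have h5 := ih (j + 1) hj
      linear_combination u ^ (j + 1) * h1 - r * h2 - u ^ (k + 1) * h3 + u * h4 + r * u * h5
        - u ^ j * (ToeplitzTlam n lam).mulVec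
          (((ToeplitzTlam n lam) ^ k).mulVec x) ⟨j, by omega⟩ * hconj
        + u ^ (j + 1) * ((ToeplitzTlam n lam) ^ k).mulVec x ⟨j + 1, hj⟩ * hlam

lemma norm_toeplitzTlam_pow_mulVec_le {r : ℝ} {u : ℂ} (hr0 : 0 < r) (hr1 : r < 1) (hu : ‖u‖ = 1)
    (hlam : lam = r * u) (hconj : (starRingEnd ℂ) lam * u = r) (x : Fin n → ℂ) (k j : ℕ)
    (hj : j < n) : ‖((ToeplitzTlam n lam) ^ k).mulVec x ⟨j, hj⟩‖ ≤ ∑ i, ‖x i‖ := by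
  have h := congrArg norm (toeplitzTlam_pow_mulVec hr0 hr1 hlam hconj x k j hj)
  rw [norm_mul, norm_mul, norm_pow, norm_pow, hu, one_pow, one_pow, one_mul, one_mul] at h
  rw [h]
  refine norm_circleAverage_le_of_norm_le fun t => ?_
  simp only [norm_mul, norm_pow, norm_inv, norm_blaschke_circleMap hr0 hr1, norm_circleMap_zero,
    abs_one, one_pow, one_mul, inv_one, mul_one]
  refine (norm_sum_le _ _).trans (le_of_eq ?_)
  simp [hu]

/-- The orbit seminorm `sup_k |(T_λ ^ k x)_{n-1}|` is a norm: boundedness of orbits propagates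
vanishing from the last coordinate to all the others. -/
lemma eq_zero_of_toeplitzTlam_orbit_last_eq_zero {r : ℝ} {u : ℂ} (hr0 : 0 < r) (hr1 : r < 1)
    (hu : ‖u‖ = 1) (hlam : lam = r * u) (hconj : (starRingEnd ℂ) lam * u = r) (x : Fin n → ℂ)
    (hn : n - 1 < n) (h : ∀ k, ((ToeplitzTlam n lam) ^ k).mulVec x ⟨n - 1, hn⟩ = 0) : x = 0 := by
  have hnl : ‖(starRingEnd ℂ) lam‖ = r := by
    rw [RCLike.norm_conj, hlam, norm_mul, hu, norm_real, Real.norm_eq_abs, abs_of_pos hr0, mul_one]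
  have key : ∀ p, ∀ hp : p < n, ∀ k,
      ((ToeplitzTlam n lam) ^ k).mulVec x ⟨n - 1 - p, by omega⟩ = 0 := by
    intro p
    induction p with
    | zero => exact fun _ => h
    | succ p ih =>
      intro hp k
      have hrec : ∀ k, ((ToeplitzTlam n lam) ^ k).mulVec x ⟨n - 1 - (p + 1), by omega⟩
          = (starRingEnd ℂ) lam
            * ((ToeplitzTlam n lam) ^ (k + 1)).mulVec x ⟨n - 1 - (p + 1), by omega⟩ := by
        intro k
        have hs := toeplitzTlam_mulVec_succ (lam := lam)
          (((ToeplitzTlam n lam) ^ k).mulVec x) (n - 1 - (p + 1)) (by omega)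
        have e : (⟨n - 1 - (p + 1) + 1, by omega⟩ : Fin n) = ⟨n - 1 - p, by omega⟩ :=
          Fin.ext (by simp only; omega)
        rw [Matrix.mulVec_mulVec, ← pow_succ', e, ih (by omega), ih (by omega)] at hs
        linear_combination -hs
      have hiter : ∀ l, ‖((ToeplitzTlam n lam) ^ k).mulVec x ⟨n - 1 - (p + 1), by omega⟩‖
          = r ^ l * ‖((ToeplitzTlam n lam) ^ (k + l)).mulVec x ⟨n - 1 - (p + 1), by omega⟩‖ := by
        intro l
        induction l with
        | zero => simp
        | succ l ihl => rw [ihl, hrec, norm_mul, hnl, pow_succ r l, mul_assoc (r ^ l), add_assoc]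
      have hlim : Filter.Tendsto (fun l : ℕ => r ^ l * ∑ i, ‖x i‖) Filter.atTop (nhds 0) := by
        simpa using (tendsto_pow_atTop_nhds_zero_of_lt_one hr0.le hr1).mul_const (∑ i, ‖x i‖)
      refine norm_le_zero_iff.1 (ge_of_tendsto' hlim fun l => ?_)
      rw [hiter l]
      gcongr
      exact norm_toeplitzTlam_pow_mulVec_le hr0 hr1 hu hlam hconj x _ _ _
  ext j
  have h1 := key (n - 1 - j) (by omega) 0
  have e : (⟨n - 1 - (n - 1 - j), by omega⟩ : Fin n) = j := Fin.ext (by simp only; omega)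
  rw [e] at h1
  simpa using h1

lemma norm_last_of_toeplitzTlam_mulVec_eq {p : ℕ} {r : ℝ} {u : ℂ} (hr0 : 0 < r)
    (hu : ‖u‖ = 1) (hlam : lam = r * u) (hconj : (starRingEnd ℂ) lam * u = r)
    {x y : Fin (p + 4) → ℂ} (hxy : (ToeplitzTlam (p + 4) lam).mulVec y = x)
    (hx : ∀ i, x i = if (i : ℕ) = 0 then 1 else if (i : ℕ) = 2 then -u⁻¹ ^ 2 else 0) :
    r ^ (p + 4) * ‖y ⟨p + 3, by omega⟩‖ = (1 - r ^ 2) ^ 2 := by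
  have hu0 : u ≠ 0 := by rw [← norm_pos_iff, hu]; norm_num
  have hnl : ‖lam‖ = r := by
    rw [hlam, norm_mul, hu, norm_real, Real.norm_eq_abs, abs_of_pos hr0, mul_one]
  have h0 := toeplitzTlam_mulVec_zero (lam := lam) y (by omega)
  have hs := fun j hj => toeplitzTlam_mulVec_succ (lam := lam) y j hj
  rw [hxy] at h0 hs
  have h1 := hs 0 (by omega)
  have h2 := hs 1 (by omega)
  have h3 := hs 2 (by omega)
  simp only [hx] at h0 h1 h2 h3
  norm_num at h0 h1 h2 h3
  have hstart : lam ^ 4 * y ⟨3, by omega⟩ = -((1 - r ^ 2) ^ 2 : ℝ) := by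
    have hcl : (starRingEnd ℂ) lam * lam = r ^ 2 := by
      rw [hlam] at hconj ⊢
      linear_combination (r : ℂ) * hconj
    have hul : lam ^ 2 * (u ^ 2)⁻¹ = r ^ 2 := by
      rw [hlam]
      field_simp
    push_cast
    linear_combination -(lam ^ 3) * h3 + lam ^ 2 * h2 - lam * h1 + h0
      - (starRingEnd ℂ) lam * lam * hul - r ^ 2 * hcl + hul + hcl
  have hiter : ∀ q, ∀ hq : q + 3 < p + 4,
      r ^ (q + 4) * ‖y ⟨q + 3, hq⟩‖ = (1 - r ^ 2) ^ 2 := by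
    intro q
    induction q with
    | zero =>
      intro _
      have := congrArg norm hstart
      rw [norm_mul, norm_pow, hnl, norm_neg, norm_real, Real.norm_eq_abs,
        abs_of_nonneg (sq_nonneg _)] at this
      exact this
    | succ q ih =>
      intro hq
      have h := hs (q + 3) (by omega)
      simp only [hx] at h
      norm_num at h
      rw [if_neg (by omega), if_neg (by omega)] at h
      have h' : ‖y ⟨q + 3, by omega⟩‖ = r * ‖y ⟨q + 1 + 3, hq⟩‖ := by
        rw [← hnl, ← norm_mul, ← norm_neg]
        congr 1
        linear_combination h
      rw [← ih (by omega), h']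
      ring
  exact hiter p (by omega)

end Toeplitz

lemma sum_single_add_single_mul_pow {p : ℕ} {u : ℂ} (hu0 : u ≠ 0) (x : Fin (p + 4) → ℂ)
    (hx : ∀ i, x i = if (i : ℕ) = 0 then 1 else if (i : ℕ) = 2 then -u⁻¹ ^ 2 else 0) (z : ℂ) :
    ∑ i : Fin (p + 4), u ^ (i : ℕ) * x i * z ^ (i : ℕ) = 1 - z ^ 2 := by
  simp only [hx]
  rw [Fin.sum_univ_eq_sum_range
    (fun i => u ^ i * (if i = 0 then 1 else if i = 2 then -u⁻¹ ^ 2 else 0) * z ^ i) (p + 4),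
    ← Finset.sum_subset (Finset.range_mono (show 3 ≤ p + 4 by omega))]
  · simp [Finset.sum_range_succ]
    field_simp
    ring
  · intro i _ hi
    have hi : 3 ≤ i := by simpa using hi
    rw [if_neg (by omega), if_neg (by omega), mul_zero, zero_mul]

/-- The seminorm `x ↦ sup_k |(T_λ ^ k x)_j|`. -/
noncomputable def orbitSeminorm (n : ℕ) (lam : ℂ) (j : Fin n) : Seminorm ℂ (Fin n → ℂ) :=
  ⨆ k : ℕ, (normSeminorm ℂ ℂ).comp
    ((LinearMap.proj j).comp (Matrix.mulVecLin (ToeplitzTlam n lam ^ k)))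

section OrbitSeminorm

variable {n : ℕ} {lam : ℂ} {r : ℝ} {u : ℂ}

lemma orbitSeminorm_apply (hr0 : 0 < r) (hr1 : r < 1) (hu : ‖u‖ = 1)
    (hlam : lam = r * u) (hconj : (starRingEnd ℂ) lam * u = r) (j : Fin n) (x : Fin n → ℂ) :
    orbitSeminorm n lam j x = ⨆ k : ℕ, ‖(ToeplitzTlam n lam ^ k).mulVec x j‖ := by
  rw [orbitSeminorm, Seminorm.iSup_apply]
  · rfl
  · rw [Seminorm.bddAbove_range_iff]
    refine fun x => ⟨∑ i, ‖x i‖, ?_⟩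
    rintro _ ⟨k, rfl⟩
    exact norm_toeplitzTlam_pow_mulVec_le hr0 hr1 hu hlam hconj x k j j.2

lemma bddAbove_norm_toeplitzTlam_pow_mulVec (hr0 : 0 < r) (hr1 : r < 1) (hu : ‖u‖ = 1)
    (hlam : lam = r * u) (hconj : (starRingEnd ℂ) lam * u = r) (j : Fin n) (x : Fin n → ℂ) :
    BddAbove (Set.range fun k : ℕ => ‖(ToeplitzTlam n lam ^ k).mulVec x j‖) := by
  refine ⟨∑ i, ‖x i‖, ?_⟩
  rintro _ ⟨k, rfl⟩
  exact norm_toeplitzTlam_pow_mulVec_le hr0 hr1 hu hlam hconj x k j j.2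

lemma norm_toeplitzTlam_pow_mulVec_le_orbitSeminorm (hr0 : 0 < r) (hr1 : r < 1) (hu : ‖u‖ = 1)
    (hlam : lam = r * u) (hconj : (starRingEnd ℂ) lam * u = r) (j : Fin n) (x : Fin n → ℂ)
    (k : ℕ) : ‖(ToeplitzTlam n lam ^ k).mulVec x j‖ ≤ orbitSeminorm n lam j x := by
  rw [orbitSeminorm_apply hr0 hr1 hu hlam hconj]
  exact le_ciSup (bddAbove_norm_toeplitzTlam_pow_mulVec hr0 hr1 hu hlam hconj j x) k

lemma orbitSeminorm_mulVec_le (hr0 : 0 < r) (hr1 : r < 1) (hu : ‖u‖ = 1)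
    (hlam : lam = r * u) (hconj : (starRingEnd ℂ) lam * u = r) (j : Fin n) (x : Fin n → ℂ) :
    orbitSeminorm n lam j ((ToeplitzTlam n lam).mulVec x) ≤ orbitSeminorm n lam j x := by
  rw [orbitSeminorm_apply hr0 hr1 hu hlam hconj]
  refine ciSup_le fun k => ?_
  rw [Matrix.mulVec_mulVec, ← pow_succ]
  exact norm_toeplitzTlam_pow_mulVec_le_orbitSeminorm hr0 hr1 hu hlam hconj j x (k + 1)

lemma eq_zero_of_orbitSeminorm_last_eq_zero (hr0 : 0 < r) (hr1 : r < 1) (hu : ‖u‖ = 1)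
    (hlam : lam = r * u) (hconj : (starRingEnd ℂ) lam * u = r) (hn : n - 1 < n) {x : Fin n → ℂ}
    (hx : orbitSeminorm n lam ⟨n - 1, hn⟩ x = 0) : x = 0 := by
  refine eq_zero_of_toeplitzTlam_orbit_last_eq_zero hr0 hr1 hu hlam hconj x hn fun k => ?_
  rw [← norm_le_zero_iff, ← hx]
  exact norm_toeplitzTlam_pow_mulVec_le_orbitSeminorm hr0 hr1 hu hlam hconj _ x k

lemma toeplitzTlam_mulVec_inv_mulVec (hlam0 : lam ≠ 0) (x : Fin n → ℂ) :
    (ToeplitzTlam n lam).mulVec ((ToeplitzTlam n lam)⁻¹.mulVec x) = x := by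
  rw [Matrix.mulVec_mulVec, Matrix.mul_nonsing_inv _ (by
    rw [toeplitzTlam_det]; exact (isUnit_iff_ne_zero.2 hlam0).pow n), Matrix.one_mulVec]

lemma toeplitzTlam_mulVec_single_last (hn : n - 1 < n) :
    (ToeplitzTlam n lam).mulVec (Pi.single ⟨n - 1, hn⟩ 1)
      = lam • (Pi.single ⟨n - 1, hn⟩ 1 : Fin n → ℂ) := by
  ext i
  rw [Matrix.mulVec_single_one]
  by_cases hi : i = ⟨n - 1, hn⟩
  · subst hi
    simp [ToeplitzTlam]
  · have hi' : ¬ (i : ℕ) = n - 1 := fun h => hi (Fin.ext h)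
    have hi'' : ¬ n - 1 < (i : ℕ) := by omega
    simp [ToeplitzTlam, hi, hi', hi'']

lemma toeplitzTlam_inv_mulVec_single_last (hlam0 : lam ≠ 0) (hn : n - 1 < n) :
    (ToeplitzTlam n lam)⁻¹.mulVec (Pi.single ⟨n - 1, hn⟩ 1)
      = lam⁻¹ • (Pi.single ⟨n - 1, hn⟩ 1 : Fin n → ℂ) := by
  have h : (Pi.single ⟨n - 1, hn⟩ 1 : Fin n → ℂ)
      = (ToeplitzTlam n lam).mulVec (lam⁻¹ • Pi.single ⟨n - 1, hn⟩ 1) := by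
    rw [Matrix.mulVec_smul, toeplitzTlam_mulVec_single_last, smul_smul, inv_mul_cancel₀ hlam0,
      one_smul]
  conv_lhs => rw [h]
  rw [Matrix.mulVec_mulVec, Matrix.nonsing_inv_mul _ (by
    rw [toeplitzTlam_det]; exact (isUnit_iff_ne_zero.2 hlam0).pow n), Matrix.one_mulVec]

lemma exists_le_orbitSeminorm_inv_mulVec (hr0 : 0 < r) (hr1 : r < 1) (hu : ‖u‖ = 1)
    (hlam : lam = r * u) (hconj : (starRingEnd ℂ) lam * u = r) (hlam0 : lam ≠ 0) (p : ℕ) :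
    ∃ x : Fin (p + 4) → ℂ, x ≠ 0 ∧
      (1 - r ^ 2) ^ 2 / (8 / r + 8) * Real.sqrt (p + 4 : ℕ)
          * orbitSeminorm (p + 4) lam ⟨p + 3, by omega⟩ x
        ≤ r ^ (p + 4) * orbitSeminorm (p + 4) lam ⟨p + 3, by omega⟩
          ((ToeplitzTlam (p + 4) lam)⁻¹.mulVec x) := by
  have hu0 : u ≠ 0 := by rw [← norm_pos_iff, hu]; norm_num
  obtain ⟨x, hx⟩ : ∃ x : Fin (p + 4) → ℂ,
      ∀ i, x i = if (i : ℕ) = 0 then 1 else if (i : ℕ) = 2 then -u⁻¹ ^ 2 else 0 :=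
    ⟨_, fun _ => rfl⟩
  refine ⟨x, fun h0 => ?_, ?_⟩
  · have := hx 0
    simp [h0] at this
  have hupper : orbitSeminorm (p + 4) lam ⟨p + 3, by omega⟩ x
      ≤ (4 / r + 4) / Real.sqrt (p + 3 : ℕ) := by
    rw [orbitSeminorm_apply hr0 hr1 hu hlam hconj]
    refine ciSup_le fun k => ?_
    have h := congrArg norm (toeplitzTlam_pow_mulVec hr0 hr1 hlam hconj x k (p + 3) (by omega))
    rw [norm_mul, norm_mul, norm_pow, norm_pow, hu, one_pow, one_pow, one_mul, one_mul] at h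
    simp only [sum_single_add_single_mul_pow hu0 x hx] at h
    rw [h]
    exact norm_circleAverage_blaschke_pow_le hr0 hr1 k (by omega)
  have hlower : (1 - r ^ 2) ^ 2 ≤ r ^ (p + 4) * orbitSeminorm (p + 4) lam ⟨p + 3, by omega⟩
      ((ToeplitzTlam (p + 4) lam)⁻¹.mulVec x) := by
    rw [← norm_last_of_toeplitzTlam_mulVec_eq hr0 hu hlam hconj
      (toeplitzTlam_mulVec_inv_mulVec hlam0 x) hx]
    gcongr
    simpa using norm_toeplitzTlam_pow_mulVec_le_orbitSeminorm hr0 hr1 hu hlam hconj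
      ⟨p + 3, by omega⟩ ((ToeplitzTlam (p + 4) lam)⁻¹.mulVec x) 0
  refine le_trans ?_ hlower
  have hsqrt : Real.sqrt (p + 4 : ℕ) ≤ 2 * Real.sqrt (p + 3 : ℕ) := by
    rw [Real.sqrt_le_left (by positivity), mul_pow, Real.sq_sqrt (by positivity)]
    push_cast
    linarith [Nat.cast_nonneg (α := ℝ) p]
  have hpos : 0 < Real.sqrt (p + 3 : ℕ) := Real.sqrt_pos.2 (by positivity)
  calc _ ≤ (1 - r ^ 2) ^ 2 / (8 / r + 8) * (2 * Real.sqrt (p + 3 : ℕ))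
        * ((4 / r + 4) / Real.sqrt (p + 3 : ℕ)) := by gcongr
    _ = (1 - r ^ 2) ^ 2 := by
      field_simp
      ring

lemma half_sq_mul_sqrt_mul_le_orbitSeminorm (hr0 : 0 < r) (hr1 : r < 1) (hnorm : ‖lam‖ = r)
    (hlam0 : lam ≠ 0) (hn : n - 1 < n) (hn3 : n ≤ 3) :
    r ^ 2 / 2 * Real.sqrt n * orbitSeminorm n lam ⟨n - 1, hn⟩ (Pi.single ⟨n - 1, hn⟩ 1)
      ≤ r ^ n * orbitSeminorm n lam ⟨n - 1, hn⟩
        ((ToeplitzTlam n lam)⁻¹.mulVec (Pi.single ⟨n - 1, hn⟩ 1)) := by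
  rw [toeplitzTlam_inv_mulVec_single_last hlam0, map_smul_eq_mul, norm_inv, hnorm, ← mul_assoc]
  refine mul_le_mul_of_nonneg_right ?_ (apply_nonneg _ _)
  have hsqrt : Real.sqrt n ≤ 2 := by
    rw [Real.sqrt_le_left (by norm_num)]
    have : (n : ℝ) ≤ 3 := by exact_mod_cast hn3
    linarith
  have hpow : r ^ 2 ≤ r ^ (n - 1) := pow_le_pow_of_le_one hr0.le hr1.le (by omega)
  calc r ^ 2 / 2 * Real.sqrt n ≤ r ^ 2 / 2 * 2 := by gcongr
    _ = r ^ 2 := by ring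
    _ ≤ r ^ (n - 1) := hpow
    _ = r ^ n * r⁻¹ := by rw [← pow_sub_one_mul (show n ≠ 0 by omega) r]; field_simp

end OrbitSeminorm

end

/-- For every fixed λ ∈ 𝔻∖{0} there is c = c(λ) > 0 such that for every n ≥ 1
there exists a norm N on ℂⁿ whose induced operator norm satisfies ‖T_λ‖ ≤ 1 (i.e.
N(T_λ x) ≤ N(x) for all x) and |λ|ⁿ·‖T_λ⁻¹‖ ≥ c·√n (i.e. the bound is attained at some
x ≠ 0, which in finite dimension is equivalent to the operator-norm lower bound). -/
theorem toeplitz_counterexample_schaffer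
    (lam : ℂ) (hlam : ‖lam‖ < 1) (hlam0 : lam ≠ 0) :
    ∃ c : ℝ, 0 < c ∧ ∀ n : ℕ, 1 ≤ n →
      ∃ N : Seminorm ℂ (Fin n → ℂ),
        (∀ x, N x = 0 → x = 0) ∧
        (∀ x, N ((ToeplitzTlam n lam).mulVec x) ≤ N x) ∧
        (∃ x : Fin n → ℂ, x ≠ 0 ∧
          c * Real.sqrt n * N x ≤ ‖lam‖ ^ n * N ((ToeplitzTlam n lam)⁻¹.mulVec x)) := by
  set r := ‖lam‖ with hr
  have hr0 : 0 < r := norm_pos_iff.2 hlam0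
  have hrc : (r : ℂ) ≠ 0 := Complex.ofReal_ne_zero.2 hr0.ne'
  have hu : ‖lam / r‖ = 1 := by
    rw [norm_div, Complex.norm_real, Real.norm_eq_abs, abs_of_pos hr0, ← hr, div_self hr0.ne']
  have hlamu : lam = r * (lam / r) := by field_simp
  have hconj : (starRingEnd ℂ) lam * (lam / r) = r := by
    rw [mul_div_assoc', mul_comm, Complex.mul_conj, Complex.normSq_eq_norm_sq, ← hr,
      Complex.ofReal_pow]
    field_simp
  have hr2 : 0 < 1 - r ^ 2 := by nlinarith
  refine ⟨min ((1 - r ^ 2) ^ 2 / (8 / r + 8)) (r ^ 2 / 2), by positivity, fun n hn => ?_⟩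
  refine ⟨orbitSeminorm n lam ⟨n - 1, by omega⟩,
    fun x => eq_zero_of_orbitSeminorm_last_eq_zero hr0 hlam hu hlamu hconj (by omega),
    orbitSeminorm_mulVec_le hr0 hlam hu hlamu hconj _, ?_⟩
  have hmin : ∀ {c : ℝ} (x : Fin n → ℂ),
      min ((1 - r ^ 2) ^ 2 / (8 / r + 8)) (r ^ 2 / 2) ≤ c →
      min ((1 - r ^ 2) ^ 2 / (8 / r + 8)) (r ^ 2 / 2) * Real.sqrt n
          * orbitSeminorm n lam ⟨n - 1, by omega⟩ x
        ≤ c * Real.sqrt n * orbitSeminorm n lam ⟨n - 1, by omega⟩ x := fun x hc => by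
    gcongr
  rcases Nat.lt_or_ge n 4 with h | h
  · exact ⟨Pi.single ⟨n - 1, by omega⟩ 1, by simp, (hmin _ (min_le_right _ _)).trans
      (half_sq_mul_sqrt_mul_le_orbitSeminorm hr0 hlam hr.symm hlam0 _ (by omega))⟩
  · obtain ⟨p, rfl⟩ := Nat.exists_eq_add_of_le' h
    obtain ⟨x, hx0, hx⟩ := exists_le_orbitSeminorm_inv_mulVec hr0 hlam hu hlamu hconj hlam0 p
    exact ⟨x, hx0, (hmin _ (min_le_left _ _)).trans hx⟩
end

section
/- Let T be an n×n complex matrix that is power bounded by C with minimal polynomial m(z) = ∏_{i=1}^d (z−λ_i), and suppose r := min_{1≤i≤d} |λ_i| > 0. Then T is invertible and ‖T⁻¹‖ ≤ C·√(d·(e − r^{2d})) / r^d, where e is Euler's number. (This refines Schäffer's bound |det T|·‖T⁻¹‖ ≤ √(en)·‖T‖^{n−1}.) -/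
open Polynomial

section Blaschke

variable {H : Type*} [NormedAddCommGroup H] [InnerProductSpace ℂ H]

/-- The numerator and the denominator of a Blaschke factor have the same modulus on an isometry. -/
lemma norm_smul_sub_isometry_apply (S : H →L[ℂ] H) (hS : ∀ x, ‖S x‖ = ‖x‖) (μ : ℂ) (x : H) :
    ‖μ • x - S x‖ = ‖x - (starRingEnd ℂ μ) • S x‖ := by
  have h : ‖μ • x - S x‖ ^ 2 = ‖x - (starRingEnd ℂ μ) • S x‖ ^ 2 := by
    rw [norm_sub_sq (𝕜 := ℂ), norm_sub_sq (𝕜 := ℂ), inner_smul_left, inner_smul_right,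
      norm_smul, norm_smul, hS, RCLike.norm_conj]
    ring
  exact (sq_eq_sq₀ (norm_nonneg _) (norm_nonneg _)).1 h

/-- A Blaschke product of an isometry `S` is isometric: the operator `W` is the inverse of its
denominator. -/
lemma exists_isometric_blaschke [CompleteSpace H] (S : H →L[ℂ] H) (hS : ∀ x, ‖S x‖ = ‖x‖)
    (e : H →ₗ[ℂ] ℂ) (he : ∀ x, e (S x) = 0) {ι : Type*} (s : Finset ι) (μ : ι → ℂ)
    (hμ : ∀ i ∈ s, ‖μ i‖ < 1) :
    ∃ W : H →L[ℂ] H, Commute W S ∧ (∀ x, e (W x) = e x) ∧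
      ∀ x, ‖aeval S (∏ i ∈ s, (C (μ i) - X)) (W x)‖ = ‖x‖ := by
  classical
  induction s using Finset.induction_on with
  | empty => exact ⟨1, Commute.one_left _, fun x => rfl, fun x => by simp⟩
  | insert a s ha ih =>
    obtain ⟨W, hWS, hWe, hW⟩ := ih fun i hi => hμ i (Finset.mem_insert_of_mem hi)
    have hS1 : ‖S‖ ≤ 1 := S.opNorm_le_bound zero_le_one fun x => by simp [hS]
    have hlt : ‖(starRingEnd ℂ (μ a)) • S‖ < 1 := by
      rw [norm_smul, RCLike.norm_conj]
      have := hμ a (Finset.mem_insert_self _ _)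
      nlinarith [norm_nonneg (μ a), norm_nonneg S]
    obtain ⟨u, hu⟩ := isUnit_one_sub_of_norm_lt_one hlt
    have hcomm : Commute (↑u⁻¹ : H →L[ℂ] H) S := by
      refine Commute.units_inv_left ?_
      rw [hu]
      exact (Commute.one_left _).sub_left ((Commute.refl S).smul_left _)
    have hux : ∀ x, (↑u⁻¹ : H →L[ℂ] H) x
        - (starRingEnd ℂ (μ a)) • S ((↑u⁻¹ : H →L[ℂ] H) x) = x := fun x => by
      have := congrArg (fun A : H →L[ℂ] H => A x) u.mul_inv
      rw [hu] at this
      simpa using this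
    refine ⟨W * ↑u⁻¹, hWS.mul_left hcomm, fun x => ?_, fun x => ?_⟩
    · have h := congrArg e (hux x)
      rw [map_sub, map_smul, he, smul_zero, sub_zero] at h
      simp [hWe, h]
    · rw [Finset.prod_insert ha, mul_comm, map_mul]
      have hswap : aeval S (C (μ a) - X) ((W * (↑u⁻¹ : H →L[ℂ] H)) x)
          = W ((μ a) • (↑u⁻¹ : H →L[ℂ] H) x - S ((↑u⁻¹ : H →L[ℂ] H) x)) := by
        have := congrArg (fun A : H →L[ℂ] H => A ((↑u⁻¹ : H →L[ℂ] H) x)) hWS.eq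
        simp only [mul_apply_eq_comp] at this
        simp [this, Algebra.algebraMap_eq_smul_one]
      rw [mul_apply_eq_comp, hswap, hW, norm_smul_sub_isometry_apply S hS, hux]

end Blaschke

section Intertwine

variable {M N : Type*} [AddCommGroup M] [Module ℂ M] [TopologicalSpace M] [IsTopologicalAddGroup M]
  [ContinuousConstSMul ℂ M]

lemma map_aeval_apply_of_intertwine [Ring N] [Algebra ℂ N] (S : M →L[ℂ] M) (b : N)
    (Φ : M →ₗ[ℂ] N) (h : ∀ x, Φ (S x) = b * Φ x) (p : ℂ[X]) (x : M) :
    Φ (aeval S p x) = aeval b p * Φ x := by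
  induction p using Polynomial.induction_on' generalizing x with
  | add p q hp hq => simp [hp, hq, add_mul]
  | monomial n c =>
    have hpow : ∀ x, Φ ((S ^ n) x) = b ^ n * Φ x := by
      induction n with
      | zero => simp
      | succ n ih => intro x; rw [pow_succ, mul_apply_eq_comp, ih, h, pow_succ, mul_assoc]
    rw [aeval_monomial, aeval_monomial]
    rw [mul_apply_eq_comp, Algebra.algebraMap_eq_smul_one, Algebra.algebraMap_eq_smul_one,
      smul_apply, one_apply_eq_self, map_smul, hpow, smul_mul_assoc, one_mul, smul_mul_assoc]

end Intertwine

/-- The Hilbert space of square summable complex sequences. -/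
noncomputable abbrev SquareSummable : Type := lp (fun _ : ℕ => ℂ) 2

namespace SquareSummable

lemma summable_norm_sq (a : SquareSummable) : Summable fun k => ‖a k‖ ^ 2 := by
  simpa using (memℓp_gen_iff (p := 2) (by simp)).1 (lp.memℓp a)

lemma norm_sq_eq (a : SquareSummable) : ‖a‖ ^ 2 = ∑' k, ‖a k‖ ^ 2 := by
  simpa using lp.norm_rpow_eq_tsum (p := 2) (by simp) a

/-- A square summable sequence as an element of `SquareSummable`. -/
noncomputable def mk (f : ℕ → ℂ) (hf : Summable fun k => ‖f k‖ ^ 2) : SquareSummable :=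
  ⟨f, (memℓp_gen_iff (p := 2) (by simp)).2 (by simpa using hf)⟩

@[simp] lemma mk_apply (f : ℕ → ℂ) (hf) (k : ℕ) : mk f hf k = f k := rfl

/-- The sequence `0, a 0, a 1, …`. -/
noncomputable def shiftFun (a : SquareSummable) : SquareSummable :=
  mk (fun k => Nat.casesOn k 0 fun j => a j)
    ((summable_nat_add_iff 1).1 (by simpa using a.summable_norm_sq))

@[simp] lemma shiftFun_zero (a : SquareSummable) : shiftFun a 0 = 0 := rfl

@[simp] lemma shiftFun_succ (a : SquareSummable) (k : ℕ) : shiftFun a (k + 1) = a k := rfl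

lemma norm_shiftFun (a : SquareSummable) : ‖shiftFun a‖ = ‖a‖ := by
  have h : ‖shiftFun a‖ ^ 2 = ‖a‖ ^ 2 := by
    rw [norm_sq_eq, norm_sq_eq, (shiftFun a).summable_norm_sq.tsum_eq_zero_add]
    simp
  exact (sq_eq_sq₀ (norm_nonneg _) (norm_nonneg _)).1 h

/-- The unilateral shift. -/
noncomputable def shift : SquareSummable →L[ℂ] SquareSummable :=
  LinearMap.mkContinuous
    { toFun := shiftFun
      map_add' := fun a b => by ext k; cases k <;> simp
      map_smul' := fun c a => by ext k; cases k <;> simp } 1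
    fun a => by simp [norm_shiftFun]

@[simp] lemma shift_apply_zero (a : SquareSummable) : shift a 0 = 0 := rfl

@[simp] lemma shift_apply_succ (a : SquareSummable) (k : ℕ) : shift a (k + 1) = a k := rfl

lemma norm_shift (a : SquareSummable) : ‖shift a‖ = ‖a‖ := norm_shiftFun a

/-- The sequence `a 1, a 2, …`. -/
noncomputable def tail (a : SquareSummable) : SquareSummable :=
  mk (fun k => a (k + 1)) ((summable_nat_add_iff 1).2 a.summable_norm_sq)

@[simp] lemma tail_apply (a : SquareSummable) (k : ℕ) : tail a k = a (k + 1) := rfl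

lemma norm_sq_eq_zero_add_tail (a : SquareSummable) : ‖a‖ ^ 2 = ‖a 0‖ ^ 2 + ‖tail a‖ ^ 2 := by
  rw [norm_sq_eq, norm_sq_eq, a.summable_norm_sq.tsum_eq_zero_add]
  simp

/-- The coefficient at index zero, as a linear functional. -/
noncomputable def evalZero : SquareSummable →ₗ[ℂ] ℂ where
  toFun a := a 0
  map_add' _ _ := rfl
  map_smul' _ _ := rfl

@[simp] lemma evalZero_apply (a : SquareSummable) : evalZero a = a 0 := rfl

/-- A Blaschke product with zeros `μ i`, as a power series: it has norm one, and it is a multiple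
of its numerator `∏ (μ i - X)`. -/
lemma exists_blaschke {ι : Type*} (s : Finset ι) (μ : ι → ℂ) (hμ : ∀ i ∈ s, ‖μ i‖ < 1) :
    ∃ h : SquareSummable, ‖aeval shift (∏ i ∈ s, (C (μ i) - X)) h‖ = 1 ∧
      aeval shift (∏ i ∈ s, (C (μ i) - X)) h 0 = ∏ i ∈ s, μ i := by
  obtain ⟨W, -, hWe, hW⟩ := exists_isometric_blaschke shift norm_shift evalZero
    (fun x => by simp) s μ hμ
  refine ⟨W (lp.single 2 0 1), ?_, ?_⟩
  · rw [hW, lp.norm_single (by simp)]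
    simp
  · rw [← evalZero_apply, map_aeval_apply_of_intertwine shift (0 : ℂ) evalZero (by simp), hWe]
    simp [map_prod]

section Calculus

variable {A : Type*} [NormedRing A] [NormedAlgebra ℂ A] {b : A} {K ρ : ℝ}

lemma summable_and_tsum_norm_smul_pow_le (hρ0 : 0 ≤ ρ) (hρ1 : ρ < 1)
    (hb : ∀ k, ‖b ^ k‖ ≤ K * ρ ^ k) (a : SquareSummable) :
    (Summable fun k => ‖a k • b ^ k‖) ∧
      ∑' k, ‖a k • b ^ k‖ ≤ K * √((1 - ρ ^ 2)⁻¹) * ‖a‖ := by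
  have hgeo : HasSum (fun k => (ρ ^ k) ^ 2) (1 - ρ ^ 2)⁻¹ := by
    simpa only [← pow_mul, mul_comm] using
      hasSum_geometric_of_lt_one (sq_nonneg ρ) (by nlinarith : ρ ^ 2 < 1)
  obtain ⟨h1, h2⟩ := Real.summable_and_inner_le_Lp_mul_Lq_tsum_of_nonneg
    (f := fun k => ‖a k‖) (g := fun k => ρ ^ k) Real.HolderConjugate.two_two
    (fun _ => norm_nonneg _) (fun k => pow_nonneg hρ0 k)
    (by simpa using a.summable_norm_sq) (by simpa using hgeo.summable)
  have hle : ∀ k, ‖a k • b ^ k‖ ≤ K * (‖a k‖ * ρ ^ k) := fun k => by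
    rw [norm_smul]
    calc ‖a k‖ * ‖b ^ k‖ ≤ ‖a k‖ * (K * ρ ^ k) := by gcongr; exact hb k
      _ = _ := by ring
  have hK : 0 ≤ K := by simpa using (norm_nonneg _).trans (hb 0)
  have hs := Summable.of_nonneg_of_le (fun _ => norm_nonneg _) hle (h1.mul_left K)
  refine ⟨hs, (hs.tsum_le_tsum hle (h1.mul_left K)).trans ?_⟩
  rw [tsum_mul_left, mul_assoc]
  refine mul_le_mul_of_nonneg_left (h2.trans_eq ?_) hK
  simp only [Real.rpow_two]
  rw [hgeo.tsum_eq, ← norm_sq_eq, ← Real.sqrt_eq_rpow, ← Real.sqrt_eq_rpow,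
    Real.sqrt_sq (norm_nonneg _), mul_comm]

variable [CompleteSpace A]

/-- The functional calculus `a ↦ ∑ a k • b ^ k` of an element with geometrically decaying powers. -/
noncomputable def calculus (hρ0 : 0 ≤ ρ) (hρ1 : ρ < 1) (hb : ∀ k, ‖b ^ k‖ ≤ K * ρ ^ k) :
    SquareSummable →ₗ[ℂ] A where
  toFun a := ∑' k, a k • b ^ k
  map_add' x y := by
    simp only [lp.coeFn_add, Pi.add_apply, add_smul]
    exact (summable_and_tsum_norm_smul_pow_le hρ0 hρ1 hb x).1.of_norm.tsum_add
      (summable_and_tsum_norm_smul_pow_le hρ0 hρ1 hb y).1.of_norm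
  map_smul' c x := by
    simp only [lp.coeFn_smul, Pi.smul_apply, smul_assoc, RingHom.id_apply]
    exact (summable_and_tsum_norm_smul_pow_le hρ0 hρ1 hb x).1.of_norm.tsum_const_smul c

variable (hρ0 : 0 ≤ ρ) (hρ1 : ρ < 1) (hb : ∀ k, ‖b ^ k‖ ≤ K * ρ ^ k)

lemma calculus_apply (a : SquareSummable) : calculus hρ0 hρ1 hb a = ∑' k, a k • b ^ k := rfl

lemma norm_calculus_le (a : SquareSummable) :
    ‖calculus hρ0 hρ1 hb a‖ ≤ K * √((1 - ρ ^ 2)⁻¹) * ‖a‖ := by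
  obtain ⟨h1, h2⟩ := summable_and_tsum_norm_smul_pow_le hρ0 hρ1 hb a
  exact (norm_tsum_le_tsum_norm h1).trans h2

lemma calculus_eq_zero_add (a : SquareSummable) :
    calculus hρ0 hρ1 hb a = a 0 • 1 + b * calculus hρ0 hρ1 hb (tail a) := by
  have h := (summable_and_tsum_norm_smul_pow_le hρ0 hρ1 hb a).1.of_norm
  have h' := (summable_and_tsum_norm_smul_pow_le hρ0 hρ1 hb (tail a)).1.of_norm
  rw [calculus_apply, calculus_apply, h.tsum_eq_zero_add, ← h'.tsum_mul_left]
  simp [pow_succ']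

lemma commute_calculus (a : SquareSummable) : Commute b (calculus hρ0 hρ1 hb a) := by
  have h := (summable_and_tsum_norm_smul_pow_le hρ0 hρ1 hb a).1.of_norm
  rw [calculus_apply, Commute, SemiconjBy, ← h.tsum_mul_left, ← h.tsum_mul_right]
  simp [← pow_succ, ← pow_succ']

lemma calculus_shift (a : SquareSummable) :
    calculus hρ0 hρ1 hb (shift a) = b * calculus hρ0 hρ1 hb a := by
  have : tail (shift a) = a := by ext k; simp
  rw [calculus_eq_zero_add, this]
  simp

end Calculus

end SquareSummable

/-- An element with geometrically decaying powers that is annihilated by a polynomial with nonzero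
roots in the unit disk is invertible, with an explicit bound on its inverse. -/
lemma exists_inverse_of_aeval_eq_zero {A : Type*} [NormedRing A] [NormedAlgebra ℂ A]
    [CompleteSpace A] {b : A} {K ρ : ℝ} (hρ0 : 0 ≤ ρ) (hρ1 : ρ < 1)
    (hb : ∀ k, ‖b ^ k‖ ≤ K * ρ ^ k) {ι : Type*} (s : Finset ι) (μ : ι → ℂ)
    (hμ : ∀ i ∈ s, ‖μ i‖ < 1) (hμ0 : ∀ i ∈ s, μ i ≠ 0)
    (hzero : aeval b (∏ i ∈ s, (C (μ i) - X)) = 0) :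
    ∃ c : A, b * c = 1 ∧ c * b = 1 ∧
      ‖c‖ ≤ K * √((1 - ρ ^ 2)⁻¹) * √(((∏ i ∈ s, ‖μ i‖) ^ 2)⁻¹ - 1) := by
  obtain ⟨h, hnorm, h0⟩ := SquareSummable.exists_blaschke s μ hμ
  set f := aeval SquareSummable.shift (∏ i ∈ s, (C (μ i) - X)) h
  have hK : 0 ≤ K := by simpa using (norm_nonneg _).trans (hb 0)
  have hβ0 : ∏ i ∈ s, μ i ≠ 0 := Finset.prod_ne_zero_iff.2 hμ0
  set β := ∏ i ∈ s, μ i with hβ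
  have hΦ : SquareSummable.calculus hρ0 hρ1 hb f = 0 := by
    rw [map_aeval_apply_of_intertwine _ b _ (SquareSummable.calculus_shift hρ0 hρ1 hb), hzero,
      zero_mul]
  set g := SquareSummable.calculus hρ0 hρ1 hb (SquareSummable.tail f) with hg
  have hbg : b * g = -(β • 1) := by
    rw [SquareSummable.calculus_eq_zero_add, h0] at hΦ
    exact eq_neg_of_add_eq_zero_right hΦ
  have hcomm : Commute b g := SquareSummable.commute_calculus hρ0 hρ1 hb _
  have hbc : b * (-(β⁻¹ • g)) = 1 := by
    rw [mul_neg, mul_smul_comm, hbg, smul_neg, neg_neg, smul_smul, inv_mul_cancel₀ hβ0, one_smul]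
  refine ⟨-(β⁻¹ • g), hbc, ?_, ?_⟩
  · rw [← ((hcomm.smul_right β⁻¹).neg_right).eq, hbc]
  · have htail : ‖SquareSummable.tail f‖ = √(1 - ‖β‖ ^ 2) := by
      have := SquareSummable.norm_sq_eq_zero_add_tail f
      rw [hnorm, h0] at this
      rw [← Real.sqrt_sq (norm_nonneg (SquareSummable.tail f))]
      congr 1
      linarith
    have hβpos : 0 < ‖β‖ := norm_pos_iff.2 hβ0
    have hsq : ‖β‖⁻¹ * √(1 - ‖β‖ ^ 2) = √((‖β‖ ^ 2)⁻¹ - 1) := by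
      have : (‖β‖ ^ 2)⁻¹ - 1 = (‖β‖⁻¹) ^ 2 * (1 - ‖β‖ ^ 2) := by field_simp
      rw [this, Real.sqrt_mul (sq_nonneg _), Real.sqrt_sq (by positivity)]
    have hgle := SquareSummable.norm_calculus_le hρ0 hρ1 hb (SquareSummable.tail f)
    rw [← hg, htail] at hgle
    rw [← norm_prod, ← hβ, norm_neg, norm_smul, norm_inv, ← hsq]
    calc ‖β‖⁻¹ * ‖g‖ ≤ ‖β‖⁻¹ * (K * √((1 - ρ ^ 2)⁻¹) * √(1 - ‖β‖ ^ 2)) := by gcongr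
      _ = _ := by ring

/-- The roots of the minimal polynomial of a power bounded element lie in the closed unit disk. -/
lemma norm_root_minpoly_le_one {A : Type*} [NormedRing A] [NormedAlgebra ℂ A] {T : A} {K : ℝ}
    (hT : ∀ j : ℕ, ‖T ^ j‖ ≤ K) (hint : IsIntegral ℂ T) {z : ℂ}
    (hz : (minpoly ℂ T).IsRoot z) : ‖z‖ ≤ 1 := by
  obtain ⟨q, hq⟩ := dvd_iff_isRoot.2 hz
  have hm0 := minpoly.ne_zero hint
  have hq0 : q ≠ 0 := by rintro rfl; exact hm0 (by simpa using hq)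
  have hQ : aeval T q ≠ 0 := fun h => by
    have hdvd := natDegree_le_of_dvd (minpoly.dvd ℂ T h) hq0
    rw [hq, natDegree_mul (X_sub_C_ne_zero z) hq0, natDegree_X_sub_C] at hdvd
    omega
  have hTQ : T * aeval T q = z • aeval T q := by
    have h := minpoly.aeval ℂ T
    rw [hq, map_mul] at h
    simpa [sub_mul, sub_eq_zero, Algebra.algebraMap_eq_smul_one] using h
  have hpow : ∀ j : ℕ, T ^ j * aeval T q = z ^ j • aeval T q := fun j => by
    induction j with
    | zero => simp
    | succ j ih => rw [pow_succ, mul_assoc, hTQ, mul_smul_comm, ih, smul_smul, pow_succ']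
  have hle : ∀ j : ℕ, ‖z‖ ^ j ≤ K := fun j => by
    have hpos : 0 < ‖aeval T q‖ := norm_pos_iff.2 hQ
    refine le_of_mul_le_mul_right ?_ hpos
    calc ‖z‖ ^ j * ‖aeval T q‖ = ‖T ^ j * aeval T q‖ := by rw [hpow, norm_smul, norm_pow]
      _ ≤ ‖T ^ j‖ * ‖aeval T q‖ := norm_mul_le _ _
      _ ≤ K * ‖aeval T q‖ := by gcongr; exact hT j
  by_contra! h
  obtain ⟨j, hj⟩ := pow_unbounded_of_one_lt K h
  exact (hle j).not_gt hj

/-- The bound on the inverse for the radius `ρ = √(d / (d + 1))`. -/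
lemma sqrt_mul_sqrt_le_of_sq_eq {d : ℕ} (hd : 0 < d) {ρ r P : ℝ} (hρ : 0 < ρ)
    (hρ2 : ρ ^ 2 = d / (d + 1)) (hr : 0 < r) (hP : r ^ d ≤ P) :
    ρ * (√((1 - ρ ^ 2)⁻¹) * √(((ρ ^ d * P) ^ 2)⁻¹ - 1)) ≤
      √((d : ℝ) * (Real.exp 1 - r ^ (2 * d))) / r ^ d := by
  have hd' : (0 : ℝ) < d := by exact_mod_cast hd
  have hrd : 0 < r ^ d := pow_pos hr d
  have hrho : (1 - ρ ^ 2)⁻¹ = (d : ℝ) + 1 := by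
    rw [hρ2, one_sub_div (by positivity), add_sub_cancel_left, inv_div, div_one]
  have hexp : ((ρ ^ d) ^ 2)⁻¹ ≤ Real.exp 1 := by
    rw [← pow_mul, mul_comm, pow_mul, hρ2, ← inv_pow, inv_div]
    calc (((d : ℝ) + 1) / d) ^ d ≤ (Real.exp (1 / d)) ^ d := by
          gcongr
          calc ((d : ℝ) + 1) / d = 1 / d + 1 := by field_simp; ring
            _ ≤ _ := Real.add_one_le_exp _
      _ = Real.exp 1 := by rw [← Real.exp_nat_mul]; congr 1; field_simp
  have hrhs : √((d : ℝ) * (Real.exp 1 - r ^ (2 * d))) / r ^ d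
      = √(d * (Real.exp 1 * ((r ^ d) ^ 2)⁻¹ - 1)) := by
    have : (d : ℝ) * (Real.exp 1 * ((r ^ d) ^ 2)⁻¹ - 1)
        = d * (Real.exp 1 - r ^ (2 * d)) / (r ^ d) ^ 2 := by
      rw [mul_comm 2 d, pow_mul]; field_simp
    rw [this, Real.sqrt_div' _ (sq_nonneg _), Real.sqrt_sq hrd.le]
  have hlhs : ρ * (√((1 - ρ ^ 2)⁻¹) * √(((ρ ^ d * P) ^ 2)⁻¹ - 1))
      = √(d * (((ρ ^ d * P) ^ 2)⁻¹ - 1)) := by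
    have : (d : ℝ) = ρ ^ 2 * (d + 1) := by rw [hρ2]; field_simp
    rw [hrho, ← mul_assoc, ← Real.sqrt_sq hρ.le, ← Real.sqrt_mul (sq_nonneg _),
      Real.sqrt_sq hρ.le, ← this, ← Real.sqrt_mul hd'.le]
  rw [hrhs, hlhs]
  refine Real.sqrt_le_sqrt ?_
  gcongr
  rw [mul_pow, mul_inv]
  gcongr

/-- If T is power bounded by C (for the operator norm induced by an arbitrary
norm on an n-dimensional complex space) with minimal polynomial ∏_{i=1}^d (z−λ_i) and
r := min_i |λ_i| > 0, then T is invertible and ‖T⁻¹‖ ≤ C·√(d·(e − r^{2d})) / r^d. -/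
theorem inverse_bound_refining_schaffer
    {E : Type*} [NormedAddCommGroup E] [NormedSpace ℂ E] [FiniteDimensional ℂ E]
    (n : ℕ) (hn : 1 ≤ n) (hdim : Module.finrank ℂ E = n)
    (T : E →L[ℂ] E) (C : ℝ) (hC : 1 ≤ C) (hpb : ∀ j : ℕ, ‖T ^ j‖ ≤ C)
    (d : ℕ) (hd : 0 < d) (lam : Fin d → ℂ)
    (hmin : minpoly ℂ T = ∏ i : Fin d, (Polynomial.X - Polynomial.C (lam i)))
    (r : ℝ)
    (hr : r = Finset.inf' Finset.univ (Finset.univ_nonempty_iff.mpr ⟨⟨0, hd⟩⟩)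
      (fun i => ‖lam i‖))
    (hrpos : 0 < r) :
    ∃ S : E →L[ℂ] E, T * S = 1 ∧ S * T = 1 ∧
      ‖S‖ ≤ C * Real.sqrt ((d : ℝ) * (Real.exp 1 - r ^ (2 * d))) / r ^ d := by
  have hlam : ∀ i, r ≤ ‖lam i‖ := fun i => hr ▸ Finset.inf'_le _ (Finset.mem_univ i)
  have hlam1 : ∀ i, ‖lam i‖ ≤ 1 := fun i => by
    have hint : IsIntegral ℂ T := by
      by_contra h
      rw [minpoly.eq_zero h] at hmin
      exact Finset.prod_ne_zero_iff.2 (fun i _ => X_sub_C_ne_zero (lam i)) hmin.symm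
    refine norm_root_minpoly_le_one hpb hint ?_
    rw [hmin, IsRoot.def, eval_prod]
    exact Finset.prod_eq_zero (Finset.mem_univ i) (by simp)
  have hd' : (0 : ℝ) < d := by exact_mod_cast hd
  set ρ : ℝ := √(d / (d + 1))
  have hρ : 0 < ρ := by positivity
  have hρ2 : ρ ^ 2 = d / (d + 1) := Real.sq_sqrt (by positivity)
  have hρ1 : ρ < 1 := by
    have : ρ ^ 2 < 1 := by rw [hρ2, div_lt_one (by positivity)]; linarith
    nlinarith
  have hnρ : ‖(ρ : ℂ)‖ = ρ := by rw [Complex.norm_real, Real.norm_of_nonneg hρ.le]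
  have hρ0 : (ρ : ℂ) ≠ 0 := by exact_mod_cast hρ.ne'
  have hb : ∀ k, ‖((ρ : ℂ) • T) ^ k‖ ≤ C * ρ ^ k := fun k => by
    rw [_root_.smul_pow, norm_smul, norm_pow, hnρ, mul_comm]
    gcongr
    exact hpb k
  have hzero : aeval ((ρ : ℂ) • T) (∏ i, (Polynomial.C ((ρ : ℂ) * lam i) - X)) = 0 := by
    have hcomp : (∏ i, (Polynomial.C ((ρ : ℂ) * lam i) - X)).comp (Polynomial.C (ρ : ℂ) * X)
        = Polynomial.C ((-(ρ : ℂ)) ^ d) * minpoly ℂ T := by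
      have hpow : (-Polynomial.C (ρ : ℂ)) ^ d = ∏ _i : Fin d, -Polynomial.C (ρ : ℂ) := by simp
      rw [hmin, prod_comp, C_pow, C_neg, hpow, ← Finset.prod_mul_distrib]
      refine Finset.prod_congr rfl fun i _ => ?_
      simp only [sub_comp, mul_comp, C_comp, X_comp, C_mul]
      ring
    have h := congrArg (aeval T) hcomp
    rw [aeval_comp, map_mul (aeval T) (Polynomial.C ((-(ρ : ℂ)) ^ d)), minpoly.aeval, mul_zero] at h
    simpa [Algebra.algebraMap_eq_smul_one] using h
  obtain ⟨c, hc1, hc2, hc⟩ := exists_inverse_of_aeval_eq_zero hρ.le hρ1 hb Finset.univ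
    (fun i => (ρ : ℂ) * lam i)
    (fun i _ => by
      rw [norm_mul, hnρ]
      nlinarith [hlam1 i, norm_nonneg (lam i)])
    (fun i _ => mul_ne_zero hρ0 (norm_pos_iff.1 (hrpos.trans_le (hlam i)))) hzero
  have hprod : ∏ i, ‖(ρ : ℂ) * lam i‖ = ρ ^ d * ∏ i, ‖lam i‖ := by
    simp [Finset.prod_mul_distrib, abs_of_pos hρ]
  rw [hprod] at hc
  have hP : r ^ d ≤ ∏ i, ‖lam i‖ := by
    simpa using Finset.prod_le_prod (s := (Finset.univ : Finset (Fin d))) (fun _ _ => hrpos.le)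
      fun i _ => hlam i
  refine ⟨(ρ : ℂ) • c, ?_, ?_, ?_⟩
  · rw [mul_smul_comm, ← smul_mul_assoc, hc1]
  · rw [smul_mul_assoc, ← mul_smul_comm, hc2]
  · rw [norm_smul, hnρ, mul_div_assoc]
    calc ρ * ‖c‖ ≤ ρ * (C * √((1 - ρ ^ 2)⁻¹) * √(((ρ ^ d * ∏ i, ‖lam i‖) ^ 2)⁻¹ - 1)) := by gcongr
      _ = C * (ρ * (√((1 - ρ ^ 2)⁻¹) * √(((ρ ^ d * ∏ i, ‖lam i‖) ^ 2)⁻¹ - 1))) := by ring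
      _ ≤ _ := by
        gcongr
        exact sqrt_mul_sqrt_le_of_sq_eq hd hρ hρ2 hrpos hP
end

section
/- Let T be an n×n complex matrix that is power bounded by C with minimal polynomial m(z) = ∏_{i=1}^d (z−λ_i). Let ζ ∈ 𝔻 and set r := min_{1≤i≤d} |(ζ − λ_i)/(1 − conj(λ_i)ζ)| (the pseudo-hyperbolic distance from ζ to the spectrum), and assume 0 < r < 1. Then ζI − T is invertible and ‖(ζI − T)⁻¹‖ ≤ C·e·√2 · √d / (min_{1≤i≤d}|1 − conj(λ_i)ζ| · r^d) · √( 1/(1 − r|ζ|) + 1/(2(1 − r²)d) ). -/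
open Finset

/-- The state recursion realising multiplication by a Blaschke factor on coefficient sequences. -/
def blaschkeState (μ η : ℂ) (u : ℕ → ℂ) : ℕ → ℂ
  | 0 => η
  | k + 1 => u k + (starRingEnd ℂ) μ * blaschkeState μ η u k

theorem sum_norm_sq_blaschkeState (μ η : ℂ) (u : ℕ → ℂ) (K : ℕ) :
    ∑ k ∈ range K, ‖blaschkeState μ η u k - μ * blaschkeState μ η u (k + 1)‖ ^ 2
        + (1 - ‖μ‖ ^ 2) * ‖blaschkeState μ η u K‖ ^ 2
      = ∑ k ∈ range K, ‖u k‖ ^ 2 + (1 - ‖μ‖ ^ 2) * ‖η‖ ^ 2 := by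
  induction K with
  | zero => simp [blaschkeState]
  | succ K ih =>
    rw [sum_range_succ, sum_range_succ]
    have hu : u K = blaschkeState μ η u (K + 1)
        - (starRingEnd ℂ) μ * blaschkeState μ η u K := by simp [blaschkeState]
    rw [hu]
    generalize blaschkeState μ η u (K + 1) = y at *
    generalize blaschkeState μ η u K = x at *
    have key : ‖x - μ * y‖ ^ 2 + (1 - ‖μ‖ ^ 2) * ‖y‖ ^ 2
        = ‖y - (starRingEnd ℂ) μ * x‖ ^ 2 + (1 - ‖μ‖ ^ 2) * ‖x‖ ^ 2 := by
      simp only [← Complex.normSq_eq_norm_sq, Complex.normSq_apply, Complex.sub_re,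
        Complex.sub_im, Complex.mul_re, Complex.mul_im, Complex.conj_re, Complex.conj_im]
      ring
    linarith

theorem norm_le_sqrt_of_sum_sq_le {c : ℕ → ℂ} {M : ℝ}
    (hc : ∀ K, ∑ k ∈ range K, ‖c k‖ ^ 2 ≤ M) (k : ℕ) : ‖c k‖ ≤ √M := by
  apply Real.le_sqrt_of_sq_le
  exact (single_le_sum (f := fun k => ‖c k‖ ^ 2) (fun i _ => by positivity)
    (self_mem_range_succ k)).trans (hc (k + 1))

section Algebra

variable {𝔸 : Type*} [NormedRing 𝔸] [NormedAlgebra ℂ 𝔸] [CompleteSpace 𝔸]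

theorem summable_smul_pow_of_bounded {A : 𝔸} (hA : Summable fun k : ℕ => ‖A ^ k‖)
    {c : ℕ → ℂ} {M : ℝ} (hc : ∀ k, ‖c k‖ ≤ M) : Summable fun k => c k • A ^ k := by
  refine Summable.of_norm_bounded (hA.mul_left M) fun k => ?_
  rw [norm_smul]
  exact mul_le_mul_of_nonneg_right (hc k) (norm_nonneg _)

/-- One step of the Blaschke interpolation: from `u` produce `v` whose generating function is
`b * u + h`, with `b` a Blaschke factor and `h` a multiple of the kernel at its zero, keeping
control of the `ℓ²` norm. -/
theorem exists_blaschke_step {A : 𝔸} (hA : Summable fun k : ℕ => ‖A ^ k‖) {μ : ℂ}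
    (hμ : ‖μ‖ < 1) (η : ℂ) {u : ℕ → ℂ} {M : ℝ} (hu : ∀ K, ∑ k ∈ range K, ‖u k‖ ^ 2 ≤ M) :
    ∃ v : ℕ → ℂ, (∀ K, ∑ k ∈ range K, ‖v k‖ ^ 2 ≤ M + (1 - ‖μ‖ ^ 2) * ‖η‖ ^ 2) ∧
      (1 - (starRingEnd ℂ) μ • A) * ∑' k, v k • A ^ k
        = (A - μ • 1) * ∑' k, u k • A ^ k + ((1 - (starRingEnd ℂ) μ * μ) * η) • 1 := by
  set p := blaschkeState μ η u with hp
  have hμ2 : 0 < 1 - ‖μ‖ ^ 2 := by nlinarith [norm_nonneg μ]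
  have hE := sum_norm_sq_blaschkeState μ η u
  rw [← hp] at hE
  have hb : ∀ k, ‖p k‖ ≤ √((M + (1 - ‖μ‖ ^ 2) * ‖η‖ ^ 2) / (1 - ‖μ‖ ^ 2)) := by
    intro k
    apply Real.le_sqrt_of_sq_le
    rw [le_div_iff₀ hμ2]
    have : 0 ≤ ∑ j ∈ range k, ‖p j - μ * p (j + 1)‖ ^ 2 := by positivity
    linarith [hE k, hu k]
  have hs0 := summable_smul_pow_of_bounded hA hb
  have hs1 := summable_smul_pow_of_bounded hA fun k => hb (k + 1)
  refine ⟨fun k => p k - μ * p (k + 1), fun K => ?_, ?_⟩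
  · have : 0 ≤ (1 - ‖μ‖ ^ 2) * ‖p K‖ ^ 2 := by positivity
    linarith [hE K, hu K]
  · set Y := ∑' k, p (k + 1) • A ^ k with hY
    have h0 : ∑' k, p k • A ^ k = η • 1 + A * Y := by
      rw [hs0.tsum_eq_zero_add, hY, ← hs1.tsum_mul_left]
      congr 1
      · simp [hp, blaschkeState]
      · refine tsum_congr fun k => ?_
        rw [mul_smul_comm, pow_succ']
    have hV : ∑' k, (p k - μ * p (k + 1)) • A ^ k = η • 1 + A * Y - μ • Y := by
      simp only [sub_smul, mul_smul]
      rw [hs0.tsum_sub (hs1.const_smul μ), h0, hs1.tsum_const_smul]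
    have hU : ∑' k, u k • A ^ k = Y - (starRingEnd ℂ) μ • (η • 1 + A * Y) := by
      rw [← h0, ← hs0.tsum_const_smul, hY, ← hs1.tsum_sub (hs0.const_smul _)]
      refine tsum_congr fun k => ?_
      rw [smul_smul, ← sub_smul]
      simp [hp, blaschkeState]
    rw [hV, hU]
    simp only [sub_mul, mul_sub, mul_add, smul_mul_assoc, mul_smul_comm, one_mul, mul_one,
      smul_add, smul_sub, smul_smul, sub_smul]
    module

open Polynomial in
/-- The `ℓ²`-controlled interpolant `(1 - B / B(a)) / (a - w)` for a finite Blaschke product `B`,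
evaluated at an algebra element with summable powers. -/
theorem exists_blaschke_interpolant {A : 𝔸} (hA : Summable fun k : ℕ => ‖A ^ k‖) {a : ℂ}
    (ha : ‖a‖ < 1) {ι : Type*} (s : Finset ι) (μ : ι → ℂ) (hμ : ∀ i, ‖μ i‖ < 1)
    (hne : ∀ i, a - μ i ≠ 0) :
    ∃ g : ℕ → ℂ,
      (∀ K, ∑ k ∈ range K, ‖g k‖ ^ 2 ≤
        ((∏ i ∈ s, ‖(1 - (starRingEnd ℂ) (μ i) * a) / (a - μ i)‖) ^ 2 - 1) / (1 - ‖a‖ ^ 2)) ∧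
      aeval A (∏ i ∈ s, (1 - C ((starRingEnd ℂ) (μ i)) * X)) * (a • 1 - A) * ∑' k, g k • A ^ k
        = aeval A (∏ i ∈ s, (1 - C ((starRingEnd ℂ) (μ i)) * X))
          - (∏ i ∈ s, (1 - (starRingEnd ℂ) (μ i) * a) / (a - μ i)) •
            aeval A (∏ i ∈ s, (X - C (μ i))) := by
  classical
  induction s using Finset.induction_on with
  | empty => exact ⟨0, by simp, by simp⟩
  | insert i s hi ih =>
    obtain ⟨u, hu, hG⟩ := ih
    have hden : 1 - (starRingEnd ℂ) (μ i) * a ≠ 0 := by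
      intro h
      have h1 : (starRingEnd ℂ) (μ i) * a = 1 := (sub_eq_zero.mp h).symm
      have h2 : ‖μ i‖ * ‖a‖ = 1 := by simpa using congrArg norm h1
      nlinarith [norm_nonneg a, norm_nonneg (μ i), hμ i]
    obtain ⟨v, hv, hV⟩ := exists_blaschke_step hA (hμ i) (1 - (starRingEnd ℂ) (μ i) * a)⁻¹ hu
    set c := (starRingEnd ℂ) (μ i) with hc
    set β := (1 - c * a) / (a - μ i) with hβ
    have ha2 : 0 < 1 - ‖a‖ ^ 2 := by nlinarith [norm_nonneg a]
    refine ⟨fun k => β * v k, fun K => ?_, ?_⟩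
    · simp only [norm_mul, mul_pow]
      rw [← mul_sum, prod_insert hi]
      refine (mul_le_mul_of_nonneg_left (hv K) (by positivity)).trans (le_of_eq ?_)
      have key : (1 - ‖μ i‖ ^ 2) * (1 - ‖a‖ ^ 2)
          = ‖1 - c * a‖ ^ 2 - ‖a - μ i‖ ^ 2 := by
        simp only [hc, ← Complex.normSq_eq_norm_sq, Complex.normSq_apply, Complex.sub_re,
          Complex.sub_im, Complex.mul_re, Complex.mul_im, Complex.conj_re, Complex.conj_im,
          Complex.one_re, Complex.one_im]
        ring
      have h1 : ‖1 - c * a‖ ≠ 0 := norm_ne_zero_iff.mpr hden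
      have h2 : ‖a - μ i‖ ≠ 0 := norm_ne_zero_iff.mpr (hne i)
      rw [hβ, norm_div, norm_inv]
      generalize (∏ i ∈ s, ‖(1 - (starRingEnd ℂ) (μ i) * a) / (a - μ i)‖) = p
      have key' : 1 - ‖μ i‖ ^ 2 = (‖1 - c * a‖ ^ 2 - ‖a - μ i‖ ^ 2) / (1 - ‖a‖ ^ 2) := by
        rw [eq_div_iff ha2.ne', key]
      rw [key']
      have := ha2.ne'
      field_simp
      ring
    · have hsum : ∑' k, (β * v k) • A ^ k = β • ∑' k, v k • A ^ k := by
        simp only [mul_smul]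
        exact tsum_const_smul'' β
      rw [hsum, prod_insert hi, prod_insert hi, prod_insert hi]
      set Q := aeval A (∏ i ∈ s, (1 - C ((starRingEnd ℂ) (μ i)) * X)) with hQ
      set P := aeval A (∏ i ∈ s, (X - C (μ i))) with hP
      set b := ∏ i ∈ s, (1 - (starRingEnd ℂ) (μ i) * a) / (a - μ i) with hb
      set U := ∑' k, u k • A ^ k
      set V := ∑' k, v k • A ^ k
      have hAQ : A * Q = Q * A := by
        have := Commute.all (X : ℂ[X]) (∏ i ∈ s, (1 - C ((starRingEnd ℂ) (μ i)) * X))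
        simpa [hQ] using congrArg (aeval A) this.eq
      have e1 : aeval A (1 - C c * X) = 1 - c • A := by
        simp [Algebra.smul_def]
      have e2 : aeval A (X - C (μ i)) = A - μ i • 1 := by
        simp [Algebra.smul_def]
      rw [map_mul, map_mul, e1, e2, ← hQ, ← hP]
      have c1 : (1 - c • A) * Q = Q * (1 - c • A) := by
        simp [sub_mul, mul_sub, hAQ]
      have c2 : (1 - c • A) * (a • 1 - A) = (a • 1 - A) * (1 - c • A) := by
        simp only [sub_mul, mul_sub, smul_mul_assoc, mul_smul_comm, one_mul, mul_one]
        module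
      have c3 : (A - μ i • 1) * (Q * (a • 1 - A)) = Q * (a • 1 - A) * (A - μ i • 1) := by
        simp only [sub_mul, mul_sub, smul_mul_assoc, mul_smul_comm, one_mul, mul_one,
          ← mul_assoc, hAQ]
        module
      calc (1 - c • A) * Q * (a • 1 - A) * (β • V)
          = β • (Q * (a • 1 - A) * ((1 - c • A) * V)) := by
            rw [c1, mul_smul_comm, mul_assoc Q, c2]; simp only [mul_assoc]
        _ = β • ((A - μ i • 1) * (Q * (a • 1 - A) * U))
            + (β * ((1 - c * μ i) * (1 - c * a)⁻¹)) • (Q * (a • 1 - A)) := by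
            rw [hV, mul_add, ← mul_assoc, ← c3, mul_smul_comm, mul_one, smul_add, smul_smul,
              mul_assoc (A - μ i • 1)]
        _ = β • ((A - μ i • 1) * Q)
            + (β * ((1 - c * μ i) * (1 - c * a)⁻¹)) • (Q * (a • 1 - A))
            - (β * b) • ((A - μ i • 1) * P) := by
            rw [hG, mul_sub, mul_smul_comm, smul_sub, smul_smul]; abel
        _ = (1 - c • A) * Q - (β * b) • ((A - μ i • 1) * P) := by
            congr 1
            simp only [sub_mul, mul_sub, smul_mul_assoc, mul_smul_comm, one_mul, mul_one,
              smul_sub, smul_smul, hAQ, hβ]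
            have h3 := hne i
            match_scalars <;> field_simp <;> ring

end Algebra

theorem norm_tsum_smul_pow_le {𝔸 : Type*} [NormedRing 𝔸] [NormedAlgebra ℂ 𝔸]
    {A : 𝔸} {D ρ E : ℝ} (hD : 0 ≤ D) (hρ0 : 0 ≤ ρ) (hρ1 : ρ < 1)
    (hA : ∀ k, ‖A ^ k‖ ≤ D * ρ ^ k) {g : ℕ → ℂ} (hg : ∀ K, ∑ k ∈ range K, ‖g k‖ ^ 2 ≤ E)
    (hs : Summable fun k => g k • A ^ k) :
    ‖∑' k, g k • A ^ k‖ ≤ D * (√E * √(1 / (1 - ρ ^ 2))) := by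
  refine le_of_tendsto hs.hasSum.tendsto_sum_nat.norm (Filter.Eventually.of_forall fun K => ?_)
  calc ‖∑ k ∈ range K, g k • A ^ k‖ ≤ ∑ k ∈ range K, D * (‖g k‖ * ρ ^ k) := by
        refine norm_sum_le_of_le _ fun k _ => ?_
        rw [norm_smul]
        calc ‖g k‖ * ‖A ^ k‖ ≤ ‖g k‖ * (D * ρ ^ k) := by gcongr; exact hA k
          _ = _ := by ring
    _ = D * ∑ k ∈ range K, ‖g k‖ * ρ ^ k := by rw [mul_sum]
    _ ≤ D * (√(∑ k ∈ range K, ‖g k‖ ^ 2) * √(∑ k ∈ range K, (ρ ^ k) ^ 2)) := by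
        gcongr
        exact Real.sum_mul_le_sqrt_mul_sqrt _ _ _
    _ ≤ _ := by
        have hρ2 : ρ ^ 2 < 1 := by nlinarith
        gcongr
        · exact hg K
        · have := hasSum_geometric_of_lt_one (sq_nonneg ρ) hρ2
          rw [one_div]
          simp only [← pow_mul, mul_comm _ 2]
          simp only [pow_mul]
          exact sum_le_hasSum _ (fun i _ => by positivity) this

section Spectrum

open Polynomial in
theorem mem_spectrum_of_minpoly_eq_prod {𝕜 𝔸 ι : Type*} [Field 𝕜] [Ring 𝔸] [Algebra 𝕜 𝔸]
    [Fintype ι] {T : 𝔸} {lam : ι → 𝕜} (h : minpoly 𝕜 T = ∏ i, (X - C (lam i))) (i : ι) :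
    lam i ∈ spectrum 𝕜 T := by
  classical
  intro hunit
  set q := ∏ j ∈ univ.erase i, (X - C (lam j)) with hq
  have hq0 : q.Monic := monic_prod_of_monic _ _ fun j _ => monic_X_sub_C _
  have hmul : minpoly 𝕜 T = (X - C (lam i)) * q := by
    rw [h, hq, mul_prod_erase univ (fun j => X - C (lam j)) (mem_univ i)]
  have h0 : (algebraMap 𝕜 𝔸 (lam i) - T) * aeval T q = 0 := by
    have := minpoly.aeval 𝕜 T
    rw [hmul, map_mul, map_sub, aeval_X, aeval_C] at this
    rw [← neg_sub, neg_mul, this, neg_zero]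
  have hdvd : minpoly 𝕜 T ∣ q := minpoly.dvd 𝕜 T ((hunit.mul_right_eq_zero).mp h0)
  have := natDegree_le_of_dvd hdvd hq0.ne_zero
  rw [hmul, (monic_X_sub_C (lam i)).natDegree_mul hq0, natDegree_X_sub_C] at this
  omega

theorem norm_le_one_of_mem_spectrum_of_pow_bounded {𝔸 : Type*} [NormedRing 𝔸]
    [NormedAlgebra ℂ 𝔸] [CompleteSpace 𝔸] {T : 𝔸} {C : ℝ} (hT : ∀ j : ℕ, ‖T ^ j‖ ≤ C)
    {z : ℂ} (hz : z ∈ spectrum ℂ T) : ‖z‖ ≤ 1 := by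
  by_contra! h
  obtain ⟨j, hj⟩ := pow_unbounded_of_one_lt (C * ‖(1 : 𝔸)‖) h
  have h1 := spectrum.norm_le_norm_mul_of_mem (spectrum.pow_mem_pow T j hz)
  rw [norm_pow] at h1
  have := mul_le_mul_of_nonneg_right (hT j) (norm_nonneg (1 : 𝔸))
  linarith

theorem isUnit_one_sub_smul_of_summable {𝔸 : Type*} [NormedRing 𝔸] [NormedAlgebra ℂ 𝔸]
    [CompleteSpace 𝔸] {A : 𝔸} (hA : Summable fun k : ℕ => ‖A ^ k‖) {c : ℂ} (hc : ‖c‖ ≤ 1) :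
    IsUnit (1 - c • A) := by
  have hs : Summable fun k : ℕ => (c • A) ^ k := by
    simp only [smul_pow]
    refine summable_smul_pow_of_bounded (M := 1) hA fun k => ?_
    rw [norm_pow]
    exact pow_le_one₀ (norm_nonneg _) hc
  exact ⟨⟨_, _, hs.one_sub_mul_tsum_pow, hs.tsum_pow_mul_one_sub⟩, rfl⟩

end Spectrum

section Estimates

theorem one_le_exp_half_mul_sqrt_pow {m : ℕ} {s : ℝ} (hs0 : 0 < s) (hs : s * (m + 1) < 1) :
    1 ≤ Real.exp (1 / 2) * √(1 - s) ^ m := by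
  have hm : (0 : ℝ) ≤ m := Nat.cast_nonneg m
  have hs1 : 0 < 1 - s := by nlinarith
  have h1 : (1 - s)⁻¹ ≤ Real.exp (s / (1 - s)) := by
    have := Real.add_one_le_exp (s / (1 - s))
    have e : s / (1 - s) + 1 = (1 - s)⁻¹ := by field_simp; ring
    linarith
  have h2 : ((1 - s)⁻¹) ^ m ≤ Real.exp 1 := by
    calc ((1 - s)⁻¹) ^ m ≤ Real.exp (s / (1 - s)) ^ m := by gcongr
      _ = Real.exp (m * (s / (1 - s))) := by rw [← Real.exp_nat_mul]
      _ ≤ Real.exp 1 := by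
        apply Real.exp_le_exp.mpr
        rw [← mul_div_assoc, div_le_one hs1]
        linarith
  have h3 : 1 ≤ Real.exp 1 * (1 - s) ^ m := by
    rw [inv_pow] at h2
    exact (inv_le_iff_one_le_mul₀ (by positivity)).mp h2
  refine (sq_le_sq₀ zero_le_one (by positivity)).mp ?_
  rw [one_pow, mul_pow, ← pow_mul, mul_comm m, pow_mul, Real.sq_sqrt hs1.le, ← Real.exp_nat_mul]
  norm_num
  exact h3

theorem one_add_pow_mul_sqrt_le {d : ℕ} (hd : 0 < d) {s : ℝ} (hs0 : 0 < s) (hs : s * d < 1) :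
    √(1 - s) * (1 + 1 / (2 * (d : ℝ))) ^ d ≤ Real.exp 1 * √(1 - s) ^ d := by
  have hd' : (0 : ℝ) < d := Nat.cast_pos.mpr hd
  have h1 : (1 + 1 / (2 * (d : ℝ))) ^ d ≤ Real.exp (1 / 2) := by
    calc (1 + 1 / (2 * (d : ℝ))) ^ d ≤ Real.exp (1 / (2 * (d : ℝ))) ^ d := by
          gcongr
          rw [add_comm]
          exact Real.add_one_le_exp _
      _ = Real.exp (1 / 2) := by
          rw [← Real.exp_nat_mul]
          congr 1
          field_simp
  obtain ⟨m, rfl⟩ : ∃ m, d = m + 1 := ⟨d - 1, by omega⟩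
  have h2 := one_le_exp_half_mul_sqrt_pow (m := m) hs0 (by exact_mod_cast hs)
  have he : Real.exp 1 = Real.exp (1 / 2) * Real.exp (1 / 2) := by
    rw [← Real.exp_add]; norm_num
  calc √(1 - s) * (1 + 1 / (2 * ((m + 1 : ℕ) : ℝ))) ^ (m + 1)
      ≤ √(1 - s) * Real.exp (1 / 2) := by gcongr
    _ ≤ √(1 - s) * Real.exp (1 / 2) * (Real.exp (1 / 2) * √(1 - s) ^ m) :=
        le_mul_of_one_le_right (by positivity) h2
    _ = _ := by rw [he]; ring

theorem norm_one_sub_conj_mul_le (z l : ℂ) :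
    ‖1 - (starRingEnd ℂ) l * z‖ ≤ |1 - ‖z‖ ^ 2| + ‖z‖ * ‖z - l‖ := by
  have h : 1 - (starRingEnd ℂ) l * z = ((1 - ‖z‖ ^ 2 : ℝ) : ℂ) + (starRingEnd ℂ) (z - l) * z := by
    push_cast
    rw [← Complex.conj_mul', map_sub]
    ring
  rw [h]
  refine (norm_add_le _ _).trans (le_of_eq ?_)
  rw [Complex.norm_real, Real.norm_eq_abs, norm_mul, Complex.norm_conj]
  ring

end Estimates

open Polynomial in
/-- Resolvent bound with a free dilation parameter `ρ ∈ (0, 1)`. -/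
theorem exists_resolvent_norm_le {𝔸 : Type*} [NormedRing 𝔸] [NormedAlgebra ℂ 𝔸]
    [CompleteSpace 𝔸] {T : 𝔸} {C : ℝ} (hC : 0 ≤ C) (hT : ∀ j : ℕ, ‖T ^ j‖ ≤ C)
    {ι : Type*} [Fintype ι] {lam : ι → ℂ} (hlam : ∀ i, ‖lam i‖ ≤ 1)
    (hzero : aeval T (∏ i, (X - Polynomial.C (lam i))) = 0) {ζ : ℂ} (hζ : ‖ζ‖ < 1)
    (hne : ∀ i, ζ - lam i ≠ 0) {ρ : ℝ} (hρ0 : 0 < ρ) (hρ1 : ρ < 1) :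
    ∃ S : 𝔸, (ζ • 1 - T) * S = 1 ∧ S * (ζ • 1 - T) = 1 ∧
      ‖S‖ ≤ ρ * (C * (√(((∏ i, ‖(1 - ρ ^ 2 * ((starRingEnd ℂ) (lam i) * ζ))
        / (ρ * (ζ - lam i))‖) ^ 2 - 1) / (1 - ‖ρ * ζ‖ ^ 2)) * √(1 / (1 - ρ ^ 2)))) := by
  have hρ' : (ρ : ℂ) ≠ 0 := by exact_mod_cast hρ0.ne'
  set A : 𝔸 := (ρ : ℂ) • T with hAdef
  have hA : ∀ k, ‖A ^ k‖ ≤ C * ρ ^ k := by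
    intro k
    rw [hAdef, _root_.smul_pow, norm_smul, norm_pow, Complex.norm_real, Real.norm_of_nonneg hρ0.le,
      mul_comm]
    gcongr
    exact hT k
  have hAs : Summable fun k : ℕ => ‖A ^ k‖ :=
    Summable.of_nonneg_of_le (fun _ => norm_nonneg _) hA
      ((summable_geometric_of_lt_one hρ0.le hρ1).mul_left C)
  have ha : ‖ρ * ζ‖ < 1 := by
    rw [norm_mul, Complex.norm_real, Real.norm_of_nonneg hρ0.le]
    nlinarith [norm_nonneg ζ]
  have hμ : ∀ i, ‖ρ * lam i‖ < 1 := by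
    intro i
    rw [norm_mul, Complex.norm_real, Real.norm_of_nonneg hρ0.le]
    nlinarith [norm_nonneg (lam i), hlam i]
  have hne' : ∀ i, (ρ * ζ : ℂ) - ρ * lam i ≠ 0 := fun i => by
    rw [← mul_sub]; exact mul_ne_zero hρ' (hne i)
  obtain ⟨g, hg, hG⟩ := exists_blaschke_interpolant hAs ha univ (fun i => ρ * lam i) hμ hne'
  have hgs : Summable fun k => g k • A ^ k :=
    summable_smul_pow_of_bounded hAs (norm_le_sqrt_of_sum_sq_le hg)
  have hP : aeval A (∏ i, (X - Polynomial.C (ρ * lam i))) = 0 := by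
    have h1 : A = aeval T (Polynomial.C (ρ : ℂ) * X) := by simp [hAdef, Algebra.smul_def]
    rw [h1, ← aeval_comp, Polynomial.prod_comp]
    have h2 : ∀ i, (X - Polynomial.C (ρ * lam i)).comp (Polynomial.C (ρ : ℂ) * X)
        = Polynomial.C (ρ : ℂ) * (X - Polynomial.C (lam i)) := by
      intro i
      simp [mul_sub]
    rw [prod_congr rfl fun i _ => h2 i, prod_mul_distrib, map_mul, hzero, mul_zero]
  have hQ : IsUnit (aeval A (∏ i, (1 - Polynomial.C ((starRingEnd ℂ) (ρ * lam i)) * X))) := by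
    refine prod_induction _ (fun p : ℂ[X] => IsUnit (aeval A p)) (fun p q hp hq => ?_) (by simp)
      fun i _ => ?_
    · rw [map_mul]; exact hp.mul hq
    · have : aeval A (1 - Polynomial.C ((starRingEnd ℂ) (ρ * lam i)) * X)
          = 1 - ((starRingEnd ℂ) (ρ * lam i)) • A := by
        simp [Algebra.smul_def]
      rw [this]
      exact isUnit_one_sub_smul_of_summable hAs (by rw [Complex.norm_conj]; exact (hμ i).le)
  rw [hP, smul_zero, sub_zero, mul_assoc] at hG
  have hinv : ((ρ * ζ : ℂ) • 1 - A) * ∑' k, g k • A ^ k = 1 :=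
    hQ.mul_left_cancel (by rw [hG, mul_one])
  have hfac : (ρ * ζ : ℂ) • 1 - A = (ρ : ℂ) • (ζ • 1 - T) := by
    rw [hAdef, smul_sub, smul_smul]
  have hcomm : Commute (ζ • 1 - T) (∑' k, g k • A ^ k) := by
    refine Commute.tsum_right _ fun k => ?_
    refine Commute.smul_right (Commute.pow_right (Commute.smul_right ?_ _) _) _
    exact ((Commute.one_left T).smul_left ζ).sub_left (Commute.refl T)
  have hS : (ζ • 1 - T) * ((ρ : ℂ) • ∑' k, g k • A ^ k) = 1 := by
    rw [mul_smul_comm, ← smul_mul_assoc, ← hfac, hinv]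
  refine ⟨(ρ : ℂ) • ∑' k, g k • A ^ k, hS, ?_, ?_⟩
  · rw [← (hcomm.smul_right (ρ : ℂ)).eq, hS]
  · rw [norm_smul, Complex.norm_real, Real.norm_of_nonneg hρ0.le]
    have h3 := norm_tsum_smul_pow_le hC hρ0.le hρ1 hA hg hgs
    have h4 : ∀ i, (1 - (starRingEnd ℂ) (ρ * lam i) * (ρ * ζ)) / (ρ * ζ - ρ * lam i)
        = (1 - ρ ^ 2 * ((starRingEnd ℂ) (lam i) * ζ)) / (ρ * (ζ - lam i)) := by
      intro i
      rw [map_mul, Complex.conj_ofReal]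
      congr 1 <;> ring
    simp only [h4] at h3
    gcongr


/-- If T is power bounded by C with minimal polynomial ∏_{i=1}^d (z−λ_i),
ζ ∈ 𝔻, and r = min_i |(ζ−λ_i)/(1−conj(λ_i)ζ)| satisfies 0 < r < 1, then ζI − T is invertible
and ‖(ζI−T)⁻¹‖ ≤ C·e·√2·√d / (min_i |1−conj(λ_i)ζ| · r^d) · √(1/(1−r|ζ|) + 1/(2(1−r²)d)). -/
theorem resolvent_bound_interior_point
    {E : Type*} [NormedAddCommGroup E] [NormedSpace ℂ E] [FiniteDimensional ℂ E]
    (n : ℕ) (hn : 1 ≤ n) (hdim : Module.finrank ℂ E = n)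
    (T : E →L[ℂ] E) (C : ℝ) (hC : 1 ≤ C) (hpb : ∀ j : ℕ, ‖T ^ j‖ ≤ C)
    (d : ℕ) (hd : 0 < d) (lam : Fin d → ℂ)
    (hmin : minpoly ℂ T = ∏ i : Fin d, (Polynomial.X - Polynomial.C (lam i)))
    (ζ : ℂ) (hζ : ‖ζ‖ < 1)
    (r : ℝ)
    (hr : r = Finset.inf' Finset.univ (Finset.univ_nonempty_iff.mpr ⟨⟨0, hd⟩⟩)
      (fun i => ‖(ζ - lam i) / (1 - (starRingEnd ℂ) (lam i) * ζ)‖))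
    (hr0 : 0 < r) (hr1 : r < 1) :
    ∃ S : E →L[ℂ] E, (ζ • 1 - T) * S = 1 ∧ S * (ζ • 1 - T) = 1 ∧
      ‖S‖ ≤ C * Real.exp 1 * Real.sqrt 2 * Real.sqrt d /
          ((Finset.inf' Finset.univ (Finset.univ_nonempty_iff.mpr ⟨⟨0, hd⟩⟩)
            (fun i => ‖1 - (starRingEnd ℂ) (lam i) * ζ‖)) * r ^ d) *
        Real.sqrt (1 / (1 - r * ‖ζ‖) + 1 / (2 * (1 - r ^ 2) * d)) := by
  have hd' : (0 : ℝ) < d := Nat.cast_pos.mpr hd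
  have hlam : ∀ i, ‖lam i‖ ≤ 1 := fun i =>
    norm_le_one_of_mem_spectrum_of_pow_bounded hpb (mem_spectrum_of_minpoly_eq_prod hmin i)
  have ha0 := norm_nonneg ζ
  have hxlt : ∀ i, ‖(starRingEnd ℂ) (lam i) * ζ‖ < 1 := fun i => by
    rw [norm_mul, Complex.norm_conj]
    nlinarith [hlam i, norm_nonneg (lam i)]
  have hx0 : ∀ i, 0 < ‖1 - (starRingEnd ℂ) (lam i) * ζ‖ := fun i => by
    have := norm_sub_norm_le (1 : ℂ) ((starRingEnd ℂ) (lam i) * ζ)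
    rw [norm_one] at this
    linarith [hxlt i]
  have hne_univ : (univ : Finset (Fin d)).Nonempty := univ_nonempty_iff.mpr ⟨⟨0, hd⟩⟩
  set δ := univ.inf' hne_univ (fun i => ‖1 - (starRingEnd ℂ) (lam i) * ζ‖) with hδ
  have hδle : ∀ i, δ ≤ ‖1 - (starRingEnd ℂ) (lam i) * ζ‖ := fun i => inf'_le _ (mem_univ i)
  have hδ0 : 0 < δ := (lt_inf'_iff _).mpr fun i _ => hx0 i
  have hrle : ∀ i, r * ‖1 - (starRingEnd ℂ) (lam i) * ζ‖ ≤ ‖ζ - lam i‖ := fun i => by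
    have : r ≤ ‖(ζ - lam i) / (1 - (starRingEnd ℂ) (lam i) * ζ)‖ :=
      hr ▸ inf'_le _ (mem_univ i)
    rwa [norm_div, le_div_iff₀ (hx0 i)] at this
  obtain ⟨i₀, -, hi₀⟩ := exists_mem_eq_inf' hne_univ
    (fun i => ‖(ζ - lam i) / (1 - (starRingEnd ℂ) (lam i) * ζ)‖)
  have hri₀ : r * ‖1 - (starRingEnd ℂ) (lam i₀) * ζ‖ = ‖ζ - lam i₀‖ := by
    rw [hr.trans hi₀, norm_div, div_mul_cancel₀ _ (hx0 i₀).ne']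
  have hra : 0 < 1 - r * ‖ζ‖ := by nlinarith
  have ha2 : 0 < 1 - ‖ζ‖ ^ 2 := by nlinarith
  have hδa : δ * (1 - r * ‖ζ‖) ≤ 1 - ‖ζ‖ ^ 2 := by
    have h1 := norm_one_sub_conj_mul_le ζ (lam i₀)
    rw [abs_of_pos ha2, ← hri₀] at h1
    nlinarith [hδle i₀]
  have hδ2 : δ < 2 := by
    have := norm_sub_le (1 : ℂ) ((starRingEnd ℂ) (lam i₀) * ζ)
    rw [norm_one] at this
    linarith [hxlt i₀, hδle i₀]
  set s := δ / (2 * d) with hs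
  have hs0 : 0 < s := by positivity
  have hsd : s * d < 1 := by
    have : s * d = δ / 2 := by rw [hs]; field_simp
    linarith
  have hs1 : s < 1 := by
    have : (1 : ℝ) ≤ d := by exact_mod_cast hd
    nlinarith
  set ρ := √(1 - s) with hρ
  have hρ0 : 0 < ρ := Real.sqrt_pos.mpr (by linarith)
  have hρ2 : ρ ^ 2 = 1 - s := Real.sq_sqrt (by linarith)
  have hρ1 : ρ < 1 := by nlinarith
  have hne : ∀ i, ζ - lam i ≠ 0 := fun i =>
    norm_pos_iff.mp ((mul_pos hr0 (hx0 i)).trans_le (hrle i))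
  obtain ⟨S, hS1, hS2, hS⟩ := exists_resolvent_norm_le (zero_le_one.trans hC) hpb hlam
    (hmin ▸ minpoly.aeval ℂ T) hζ hne hρ0 hρ1
  refine ⟨S, hS1, hS2, hS.trans ?_⟩
  have hfac : ∀ i, ‖(1 - ρ ^ 2 * ((starRingEnd ℂ) (lam i) * ζ)) / (ρ * (ζ - lam i))‖
      ≤ (1 + 1 / (2 * d)) / (ρ * r) := fun i => by
    have hsplit : 1 - (ρ : ℂ) ^ 2 * ((starRingEnd ℂ) (lam i) * ζ)
        = (1 - (starRingEnd ℂ) (lam i) * ζ) + (s : ℂ) * ((starRingEnd ℂ) (lam i) * ζ) := by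
      have : (ρ : ℂ) ^ 2 = 1 - s := by exact_mod_cast hρ2
      rw [this]; ring
    have hnum : ‖1 - (ρ : ℂ) ^ 2 * ((starRingEnd ℂ) (lam i) * ζ)‖
        ≤ (1 + 1 / (2 * d)) * ‖1 - (starRingEnd ℂ) (lam i) * ζ‖ := by
      rw [hsplit]
      refine (norm_add_le _ _).trans ?_
      rw [norm_mul (s : ℂ), Complex.norm_real, Real.norm_of_nonneg hs0.le, add_mul, one_mul]
      refine add_le_add_right ?_ _
      calc s * ‖(starRingEnd ℂ) (lam i) * ζ‖ ≤ s * 1 := by gcongr; exact (hxlt i).le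
        _ = 1 / (2 * d) * δ := by rw [hs]; ring
        _ ≤ _ := by gcongr; exact hδle i
    rw [norm_div, norm_mul (ρ : ℂ), Complex.norm_real, Real.norm_of_nonneg hρ0.le,
      div_le_div_iff₀ (mul_pos hρ0 (norm_pos_iff.mpr (hne i))) (by positivity)]
    calc _ ≤ (1 + 1 / (2 * d)) * ‖1 - (starRingEnd ℂ) (lam i) * ζ‖ * (ρ * r) := by gcongr
      _ = (1 + 1 / (2 * d)) * (ρ * (r * ‖1 - (starRingEnd ℂ) (lam i) * ζ‖)) := by ring
      _ ≤ _ := by gcongr; exact hrle i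
  set p := ∏ i, ‖(1 - ρ ^ 2 * ((starRingEnd ℂ) (lam i) * ζ)) / (ρ * (ζ - lam i))‖ with hp
  have hp0 : 0 ≤ p := prod_nonneg fun i _ => norm_nonneg _
  have hpr : ρ * p ≤ Real.exp 1 / r ^ d := by
    have h1 : p ≤ ((1 + 1 / (2 * d)) / (ρ * r)) ^ d := by
      refine (prod_le_prod (fun i _ => norm_nonneg _) fun i _ => hfac i).trans (le_of_eq ?_)
      rw [prod_const, card_univ, Fintype.card_fin]
    have h2 := one_add_pow_mul_sqrt_le hd hs0 hsd
    calc ρ * p ≤ ρ * ((1 + 1 / (2 * d)) / (ρ * r)) ^ d := by gcongr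
      _ = ρ * (1 + 1 / (2 * d)) ^ d / (ρ ^ d * r ^ d) := by
        rw [div_pow, mul_pow]; ring
      _ ≤ Real.exp 1 * ρ ^ d / (ρ ^ d * r ^ d) := by gcongr
      _ = _ := by field_simp
  have hsq1 : √((p ^ 2 - 1) / (1 - ‖ρ * ζ‖ ^ 2)) ≤ p * √(1 / (δ * (1 - r * ‖ζ‖))) := by
    rw [← Real.sqrt_sq hp0, ← Real.sqrt_mul (by positivity), Real.sqrt_sq hp0]
    apply Real.sqrt_le_sqrt
    rw [mul_one_div]
    have : ‖(ρ : ℂ) * ζ‖ ≤ ‖ζ‖ := by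
      rw [norm_mul, Complex.norm_real, Real.norm_of_nonneg hρ0.le]
      nlinarith
    have h3 : ‖(ρ : ℂ) * ζ‖ ^ 2 ≤ ‖ζ‖ ^ 2 := by gcongr
    gcongr
    · linarith
    · linarith
  have hsq2 : √(1 / (1 - ρ ^ 2)) = √2 * √d * √(1 / δ) := by
    rw [hρ2, ← Real.sqrt_mul (by norm_num), ← Real.sqrt_mul (by positivity), hs]
    congr 1
    rw [sub_sub_cancel, one_div_div, mul_one_div]
  have hδs : √(1 / δ) * √(1 / δ) = 1 / δ := Real.mul_self_sqrt (by positivity)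
  have hr2 : 0 < 1 - r ^ 2 := by nlinarith
  calc ρ * (C * (√((p ^ 2 - 1) / (1 - ‖ρ * ζ‖ ^ 2)) * √(1 / (1 - ρ ^ 2))))
      ≤ ρ * (C * (p * √(1 / (δ * (1 - r * ‖ζ‖))) * √(1 / (1 - ρ ^ 2)))) := by gcongr
    _ = C * (ρ * p) * √2 * √d * (√(1 / δ) * √(1 / δ)) * √(1 / (1 - r * ‖ζ‖)) := by
      rw [hsq2, ← one_div_mul_one_div, Real.sqrt_mul (by positivity)]
      ring
    _ ≤ C * (Real.exp 1 / r ^ d) * √2 * √d * (1 / δ)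
        * √(1 / (1 - r * ‖ζ‖) + 1 / (2 * (1 - r ^ 2) * d)) := by
      rw [hδs]
      gcongr
      exact le_add_of_nonneg_right (by positivity)
    _ = _ := by
      field_simp
end
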